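/- There is an absolute constant C > 0 with the following property. Let p be a prime and let P, Q ∈ F_p[x] be such that φ(P,Q) is absolutely irreducible over F_p, and let d be the total degree of φ(P,Q). Then |J(P,Q) − p| ≤ C·d²·√p, where J(P,Q) is the number of pairs (x,y) ∈ F_p × F_p with φ(P,Q)(x,y) = 0. -/

import Mathlib

section Polynomial

open Polynomial

/-- An increasing multiplicative filtration of a `k`-algebra by subspaces. -/
structure DegFil (k R : Type*) [Field k] [CommRing R] [Algebra k R] where
  carrier : ℤ → Submodule k R
  one_mem : 1 ∈ carrier 0
  mul_mem : ∀ {m n a b}, a ∈ carrier m → b ∈ carrier n → a * b ∈ carrier (m + n)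
  mono : ∀ {m n}, m ≤ n → carrier m ≤ carrier n

namespace DegFil

variable {k R S : Type*} [Field k] [CommRing R] [Algebra k R] [CommRing S] [Algebra k S]

/-- The filtration with `R` in every nonnegative degree and `0` in negative degrees. -/
def triv (k R : Type*) [Field k] [CommRing R] [Algebra k R] : DegFil k R where
  carrier n := if 0 ≤ n then ⊤ else ⊥
  one_mem := by simp
  mul_mem {m n a b} ha hb := by
    by_cases hm : 0 ≤ m
    · by_cases hn : 0 ≤ n
      · simp [add_nonneg hm hn]
      · simp only [hn, if_false, Submodule.mem_bot] at hb
        simp [hb]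
    · simp only [hm, if_false, Submodule.mem_bot] at ha
      simp [ha]
  mono {m n} h := by
    by_cases hm : 0 ≤ m
    · simp [hm, hm.trans h]
    · simp [hm]

theorem mem_triv_of_nonneg {n : ℤ} (h : 0 ≤ n) (a : R) : a ∈ (triv k R).carrier n := by
  simp [triv, h]

theorem eq_zero_of_mem_triv {n : ℤ} (h : n < 0) {a : R} (ha : a ∈ (triv k R).carrier n) :
    a = 0 := by
  have h' : ¬ 0 ≤ n := not_le.2 h
  simpa [triv, h'] using ha

/-- The filtration of `R[X]` in which `X` has degree one. -/
def poly (F : DegFil k R) : DegFil k R[X] where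
  carrier n :=
    { carrier := {G | ∀ i : ℕ, G.coeff i ∈ F.carrier (n - i)}
      add_mem' := fun ha hb i => by
        rw [coeff_add]; exact add_mem (ha i) (hb i)
      zero_mem' := fun i => by simp
      smul_mem' := fun c G hG i => by
        rw [coeff_smul]; exact Submodule.smul_mem _ _ (hG i) }
  one_mem i := by
    rw [coeff_one]
    split_ifs with h
    · subst h; simpa using F.one_mem
    · simp
  mul_mem {m n a b} ha hb i := by
    rw [coeff_mul]
    refine sum_mem fun x hx => ?_
    have hx' : x.1 + x.2 = i := by simpa using hx
    have := F.mul_mem (ha x.1) (hb x.2)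
    have e : (m - x.1 : ℤ) + (n - x.2) = m + n - i := by rw [← hx']; push_cast; ring
    rwa [e] at this
  mono h G hG i := F.mono (by omega) (hG i)

theorem C_mem_poly {F : DegFil k R} {n : ℤ} {a : R} (h : a ∈ F.carrier n) :
    C a ∈ F.poly.carrier n := fun i => by
  rw [coeff_C]
  split_ifs with hi
  · subst hi; simpa using h
  · simp

theorem X_mem_poly (F : DegFil k R) : X ∈ F.poly.carrier 1 := fun i => by
  rw [coeff_X]
  split_ifs with hi
  · subst hi; simpa using F.one_mem
  · simp

theorem pow_mem (F : DegFil k R) {m : ℤ} {a : R} (h : a ∈ F.carrier m) (n : ℕ) :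
    a ^ n ∈ F.carrier (n * m) := by
  induction n with
  | zero => simpa using F.one_mem
  | succ n ih =>
    rw [pow_succ]
    have := F.mul_mem ih h
    have e : (n : ℤ) * m + m = (n + 1 : ℕ) * m := by push_cast; ring
    rwa [e] at this

theorem prod_mem (F : DegFil k R) {ι : Type*} (s : Finset ι) (m : ι → ℤ) (a : ι → R)
    (h : ∀ i ∈ s, a i ∈ F.carrier (m i)) : ∏ i ∈ s, a i ∈ F.carrier (∑ i ∈ s, m i) := by
  classical
  induction s using Finset.induction_on with
  | empty => simpa using F.one_mem
  | insert i s hi ih =>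
    rw [Finset.prod_insert hi, Finset.sum_insert hi]
    exact F.mul_mem (h i (by simp)) (ih fun j hj => h j (by simp [hj]))

theorem divByMonic_modByMonic_mem (F : DegFil k R) {g : R[X]} (hg : g.Monic) {d : ℕ}
    (hd : g.natDegree = d) (hgm : g ∈ F.poly.carrier d) (n : ℤ) (G : R[X])
    (hG : G ∈ F.poly.carrier n) :
    G /ₘ g ∈ F.poly.carrier (n - d) ∧ G %ₘ g ∈ F.poly.carrier n := by
  nontriviality R
  induction hN : G.natDegree using Nat.strong_induction_on generalizing G with
  | _ N ih =>
  by_cases hlt : G.degree < g.degree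
  · rw [(divByMonic_eq_zero_iff hg).2 hlt, (modByMonic_eq_self_iff hg).2 hlt]
    exact ⟨zero_mem _, hG⟩
  push Not at hlt
  have hG0 : G ≠ 0 := by
    rintro rfl
    rw [degree_zero, le_bot_iff, degree_eq_bot] at hlt
    exact hg.ne_zero hlt
  have hle : d ≤ N := by rw [← hN, ← hd]; exact natDegree_le_natDegree hlt
  set q : R[X] := C G.leadingCoeff * X ^ (N - d) with hq
  have hqm : q ∈ F.poly.carrier (n - d) := by
    have h1 := F.poly.mul_mem (C_mem_poly (hG G.natDegree)) (F.poly.pow_mem F.X_mem_poly (N - d))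
    rw [hN] at h1
    have e : n - (N : ℤ) + ((N - d : ℕ) : ℤ) * 1 = n - d := by
      push_cast [hle]; ring
    rw [e] at h1
    rwa [hq, leadingCoeff, hN]
  have hG' : G - q * g ∈ F.poly.carrier n := by
    refine sub_mem hG ?_
    have := F.poly.mul_mem hqm hgm
    simpa using this
  have key : G - q * g = 0 ∨ (G - q * g).natDegree < N := by
    by_cases h0 : G - q * g = 0
    · exact Or.inl h0
    right
    have := div_wf_lemma ⟨hlt, hG0⟩ hg
    rw [← hN]
    apply natDegree_lt_natDegree h0
    rwa [hq, ← hN, ← hd, mul_comm _ g]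
  have hrec : (G - q * g) /ₘ g ∈ F.poly.carrier (n - d) ∧
      (G - q * g) %ₘ g ∈ F.poly.carrier n := by
    rcases key with h0 | h0
    · rw [h0]; simp
    · exact ih _ h0 _ hG' rfl
  have huniq := div_modByMonic_unique (f := G) (q + (G - q * g) /ₘ g) ((G - q * g) %ₘ g) hg
    ⟨by
      have := modByMonic_add_div (G - q * g) g
      linear_combination this, degree_modByMonic_lt _ hg⟩
  rw [huniq.1, huniq.2]
  exact ⟨add_mem hqm hrec.1, hrec.2⟩

/-- The image of a filtration under an algebra homomorphism. -/
def map (F : DegFil k R) (φ : R →ₐ[k] S) : DegFil k S where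
  carrier n := (F.carrier n).map φ.toLinearMap
  one_mem := ⟨1, F.one_mem, by simp⟩
  mul_mem := by
    rintro m n _ _ ⟨a, ha, rfl⟩ ⟨b, hb, rfl⟩
    exact ⟨a * b, F.mul_mem ha hb, by simp⟩
  mono h := Submodule.map_mono (F.mono h)

theorem natDegree_le_of_mem_triv_poly {m : ℕ} {G : R[X]}
    (h : G ∈ (triv k R).poly.carrier m) : G.natDegree ≤ m := by
  rw [natDegree_le_iff_coeff_eq_zero]
  intro N hN
  exact eq_zero_of_mem_triv (by omega) (h N)

theorem mem_triv_poly_of_natDegree_le {m : ℕ} {G : R[X]} (h : G.natDegree ≤ m) :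
    G ∈ (triv k R).poly.carrier m := fun i => by
  by_cases hi : i ≤ m
  · exact mem_triv_of_nonneg (by omega) _
  · rw [coeff_eq_zero_of_natDegree_lt (by omega)]; simp

end DegFil

section Norm

variable {S B T ι : Type*} [CommRing S] [CommRing B] [Algebra S B] [CommRing T] [Fintype ι]

theorem dvd_algebraMap_norm_of_basis (b : Module.Basis ι S B) (x : B) :
    x ∣ algebraMap S B (Algebra.norm S x) := by
  classical
  set M := Algebra.leftMulMatrix b x with hM
  have h0 : aeval x M.charpoly = 0 := by
    apply Algebra.leftMulMatrix_injective b
    rw [map_zero, ← aeval_algHom_apply, ← hM, Matrix.aeval_self_charpoly]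
  have h1 : x ∣ algebraMap S B (M.charpoly.coeff 0) := by
    have h2 := congrArg (aeval x) (X_mul_divX_add M.charpoly)
    rw [h0, map_add, map_mul, aeval_X, aeval_C] at h2
    exact ⟨-aeval x M.charpoly.divX, by linear_combination h2⟩
  rw [Algebra.norm_eq_matrix_det b, Matrix.det_eq_sign_charpoly_coeff, map_mul]
  exact h1.mul_left _

theorem map_norm_add_smul_of_basis (b : Module.Basis ι S B) (π : S →+* T) {s : S} (hs : π s = 0)
    (x y : B) : π (Algebra.norm S (x + s • y)) = π (Algebra.norm S x) := by
  classical
  rw [Algebra.norm_eq_matrix_det b, Algebra.norm_eq_matrix_det b, RingHom.map_det, RingHom.map_det]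
  congr 1
  ext i j
  simp [hs]

end Norm

namespace AdjoinRoot

variable {S T : Type*} [CommRing S] [CommRing T] {g : S[X]}

theorem powerBasisAux'_apply (hg : g.Monic) (j : Fin g.natDegree) :
    powerBasisAux' hg j = root g ^ (j : ℕ) :=
  congrFun (powerBasis' hg).coe_basis j

theorem leftMulMatrix_apply (hg : g.Monic) (G : S[X]) (i j : Fin g.natDegree) :
    Algebra.leftMulMatrix (powerBasisAux' hg) (mk g G) i j = ((G * X ^ (j : ℕ)) %ₘ g).coeff i := by
  classical
  rw [Algebra.leftMulMatrix_eq_repr_mul, powerBasisAux'_repr_apply_to_fun, powerBasisAux'_apply,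
    ← mk_X, ← map_pow, ← map_mul, modByMonicHom_mk]

theorem dvd_of_norm (hg : g.Monic) (x : AdjoinRoot g) :
    x ∣ of g (Algebra.norm S x) := by
  classical
  exact dvd_algebraMap_norm_of_basis (powerBasisAux' hg) x

theorem map_norm_add_of_mul (hg : g.Monic) (π : S →+* T) {s : S} (hs : π s = 0)
    (x y : AdjoinRoot g) :
    π (Algebra.norm S (x + of g s * y)) = π (Algebra.norm S x) := by
  have := map_norm_add_smul_of_basis (powerBasisAux' hg) π hs x y
  rwa [Algebra.smul_def] at this

theorem norm_of (hg : g.Monic) (s : S) : Algebra.norm S (of g s) = s ^ g.natDegree := by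
  have := Algebra.norm_algebraMap_of_basis (powerBasisAux' hg) s
  rwa [Fintype.card_fin] at this

theorem norm_of_sub_root [Nontrivial S] (hg : g.Monic) (c : S) :
    Algebra.norm S (of g c - root g) = g.eval c := by
  classical
  set b := powerBasisAux' hg
  set M := Algebra.leftMulMatrix b (root g) with hM
  have h0 : aeval (root g) M.charpoly = 0 := by
    apply Algebra.leftMulMatrix_injective b
    rw [map_zero, ← aeval_algHom_apply, ← hM, Matrix.aeval_self_charpoly]
  have h1 : M.charpoly = g := by
    refine eq_of_monic_of_dvd_of_natDegree_le hg M.charpoly_monic ?_ ?_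
    · rwa [aeval_eq, mk_eq_zero] at h0
    · rw [M.charpoly_natDegree_eq_dim, Fintype.card_fin]
  conv_rhs => rw [← h1]
  rw [Matrix.eval_charpoly, Algebra.norm_eq_matrix_det b, map_sub]
  congr 2
  rw [← algebraMap_eq, AlgHom.commutes]
  rfl

theorem norm_ne_zero [IsDomain S] [IsDomain (AdjoinRoot g)] (hg : g.Monic) {x : AdjoinRoot g}
    (hx : x ≠ 0) : Algebra.norm S x ≠ 0 := by
  have := hg.free_adjoinRoot
  have := hg.finite_adjoinRoot
  exact Algebra.norm_ne_zero_iff.2 hx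

theorem natDegree_norm_le {k R : Type*} [Field k] [CommRing R] [Algebra k R] [Nontrivial R]
    {g : R[X][X]} (hg : g.Monic) (hgm : g ∈ (DegFil.triv k R).poly.poly.carrier g.natDegree)
    {m : ℕ} {G : R[X][X]} (hG : G ∈ (DegFil.triv k R).poly.poly.carrier m) :
    (Algebra.norm R[X] (mk g G)).natDegree ≤ g.natDegree * m := by
  classical
  rw [Algebra.norm_eq_matrix_det (powerBasisAux' hg), Matrix.det_apply]
  apply DegFil.natDegree_le_of_mem_triv_poly (k := k)
  refine sum_mem fun σ _ => ?_
  have key : ∏ i, Algebra.leftMulMatrix (powerBasisAux' hg) (mk g G) (σ i) i ∈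
      (DegFil.triv k R).poly.carrier (∑ i : Fin g.natDegree, ((m : ℤ) + i - σ i)) := by
    refine DegFil.prod_mem _ _ _ _ fun i _ => ?_
    rw [leftMulMatrix_apply]
    have h1 := DegFil.mul_mem _ hG (DegFil.pow_mem _ (DegFil.X_mem_poly _) (i : ℕ))
    have h2 := (DegFil.divByMonic_modByMonic_mem _ hg rfl hgm _ _ h1).2 (σ i)
    convert h2 using 2
    ring
  have e : ∑ i : Fin g.natDegree, ((m : ℤ) + i - σ i) = (g.natDegree * m : ℕ) := by
    rw [Finset.sum_sub_distrib, Finset.sum_add_distrib,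
      Equiv.sum_comp σ (fun i : Fin g.natDegree => ((i : ℕ) : ℤ))]
    simp
  rw [e] at key
  rcases Int.units_eq_one_or (Equiv.Perm.sign σ) with h | h
  · rw [h, one_smul]; exact key
  · rw [h, Units.neg_smul, one_smul]; exact neg_mem key

end AdjoinRoot

section Auxiliary

variable {A : Type*} [CommRing A]

/-- The reduction `A[W][Y] → A[Y]` modulo `W`. -/
noncomputable def reduceInner (A : Type*) [CommRing A] : A[X][X] →+* A[X] :=
  mapRingHom constantCoeff

theorem reduceInner_C_X : reduceInner A (C X) = 0 := by
  simp [reduceInner]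

theorem reduceInner_map_C (g : A[X]) : reduceInner A (g.map C) = g := by
  ext i
  simp [reduceInner]

theorem C_X_dvd_of_reduceInner_eq_zero {G : A[X][X]} (h : reduceInner A G = 0) : C X ∣ G := by
  rw [C_dvd_iff_dvd_coeff]
  intro i
  rw [X_dvd_iff]
  have := congrArg (coeff · i) h
  simpa [reduceInner] using this

theorem coeffs_eq_zero_of_sum_eq [IsDomain A] {F τ : A[X][X]} (hF : F.Monic) {n : ℕ}
    (H : ∀ (M : ℕ) (g : A[X]), g.degree < n →
      reduceInner A F ∣ reduceInner A τ ^ M * g → g = 0)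
    (M : ℕ) (γ : ℕ → A[X]) (hγ : ∀ j, (γ j).degree < n) (G K : A[X][X])
    (h : ∑ j ∈ Finset.range M, τ ^ (j + 1) * C X ^ (M - 1 - j) * (γ j).map C =
      C X ^ M * G + F * K) : ∀ j < M, γ j = 0 := by
  induction M generalizing K with
  | zero => intro j hj; omega
  | succ M ih =>
    have hsum : ∑ j ∈ Finset.range M, τ ^ (j + 1) * C X ^ (M + 1 - 1 - j) * (γ j).map C =
        C X * ∑ j ∈ Finset.range M, τ ^ (j + 1) * C X ^ (M - 1 - j) * (γ j).map C := by
      rw [Finset.mul_sum]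
      refine Finset.sum_congr rfl fun j hj => ?_
      have hj' := Finset.mem_range.1 hj
      rw [show M + 1 - 1 - j = (M - 1 - j) + 1 by omega, pow_succ]
      ring
    rw [Finset.sum_range_succ, hsum] at h
    have h0 := congrArg (reduceInner A) h
    simp only [map_add, map_mul, map_pow, reduceInner_C_X, zero_mul, zero_add, reduceInner_map_C,
      pow_succ, mul_zero] at h0
    simp only [Nat.add_sub_cancel, Nat.sub_self, pow_zero, mul_one] at h0
    have hM : γ M = 0 := by
      refine H (M + 1) _ (hγ M) ⟨reduceInner A K, ?_⟩
      rw [pow_succ]; exact h0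
    rw [hM, mul_zero] at h0
    have hF0 : reduceInner A F ≠ 0 := (hF.map _).ne_zero
    obtain ⟨K', rfl⟩ := C_X_dvd_of_reduceInner_eq_zero
      ((mul_eq_zero.1 h0.symm).resolve_left hF0)
    have hC : (C X : A[X][X]) ≠ 0 := by simp
    rw [hM, Polynomial.map_zero, mul_zero, add_zero] at h
    have := ih K' (mul_left_cancel₀ hC (by rw [h]; ring))
    intro j hj
    rcases Nat.lt_succ_iff_lt_or_eq.1 hj with hj | rfl
    · exact this j hj
    · exact hM

variable {k : Type*} [Field k] [Algebra k A]

/-- The combination `∑ τ ^ (j + 1) W ^ (M - 1 - j) γ_j` where `γ_j ∈ A[Y]` has coefficients in `V`,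
as a linear function of these coefficients. -/
noncomputable def auxCombination (τ : A[X][X]) (V : Submodule k A) (M n : ℕ) :
    (Fin M → Fin n → V) →ₗ[k] A[X][X] where
  toFun c := ∑ j : Fin M, ∑ i : Fin n,
    τ ^ (j + 1 : ℕ) * C X ^ (M - 1 - j : ℕ) * (C (C (c j i : A)) * X ^ (i : ℕ))
  map_add' c c' := by
    simp only [Pi.add_apply, Submodule.coe_add, map_add, add_mul, mul_add, Finset.sum_add_distrib]
  map_smul' r c := by
    simp only [Pi.smul_apply, Submodule.coe_smul, ← smul_C, RingHom.id_apply, Finset.smul_sum,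
      smul_mul_assoc, mul_smul_comm]

theorem auxCombination_eq (τ : A[X][X]) (V : Submodule k A) (M n : ℕ) (c : Fin M → Fin n → V) :
    auxCombination τ V M n c = ∑ j ∈ Finset.range M, τ ^ (j + 1) * C X ^ (M - 1 - j) *
      (if h : j < M then ∑ i : Fin n, C (c ⟨j, h⟩ i : A) * X ^ (i : ℕ) else 0 : A[X]).map C := by
  rw [Finset.sum_range]
  simp only [auxCombination, LinearMap.coe_mk, AddHom.coe_mk]
  refine Finset.sum_congr rfl fun j _ => ?_
  simp [Polynomial.map_sum, Finset.mul_sum]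

theorem auxCombination_mem {Fil : DegFil k A} {τ : A[X][X]} {δ : ℕ} (hδ : 1 ≤ δ)
    (hτ : τ ∈ Fil.poly.poly.carrier δ) {V : Submodule k A} {M n : ℕ} {T : ℤ}
    (hV : V ≤ Fil.carrier (T - δ * M - n)) (c : Fin M → Fin n → V) :
    auxCombination τ V M n c ∈ Fil.poly.poly.carrier T := by
  simp only [auxCombination, LinearMap.coe_mk, AddHom.coe_mk]
  refine sum_mem fun j _ => sum_mem fun i _ => ?_
  have h1 := DegFil.mul_mem _ (DegFil.pow_mem _ hτ (j + 1 : ℕ))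
    (DegFil.pow_mem _ (DegFil.C_mem_poly (DegFil.X_mem_poly Fil)) (M - 1 - j : ℕ))
  have h2 := DegFil.mul_mem _ (DegFil.C_mem_poly (DegFil.C_mem_poly (hV (c j i).2)))
    (DegFil.pow_mem _ (DegFil.X_mem_poly Fil.poly) (i : ℕ))
  refine DegFil.mono _ ?_ (DegFil.mul_mem _ h1 h2)
  have hj := j.2
  have hi := i.2
  obtain ⟨e, he⟩ : ∃ e, M = j + 1 + e := ⟨M - 1 - j, by omega⟩
  have e1 : M - 1 - (j : ℕ) = e := by omega
  have he' : (M : ℤ) = j + 1 + e := by exact_mod_cast he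
  rw [e1, he']
  push_cast
  have : (e : ℤ) ≤ δ * e := by
    have : (1 : ℤ) ≤ δ := by exact_mod_cast hδ
    nlinarith
  have : ((i : ℕ) : ℤ) ≤ n := by exact_mod_cast hi.le
  nlinarith

theorem exists_auxiliary [IsDomain A] {Fil : DegFil k A} {F τ : A[X][X]} (hF : F.Monic)
    (hFm : F ∈ Fil.poly.poly.carrier F.natDegree) {n δ : ℕ} (hδ : 1 ≤ δ)
    (hτ : τ ∈ Fil.poly.poly.carrier δ)
    (H : ∀ (M : ℕ) (g : A[X]), g.degree < n →
      reduceInner A F ∣ reduceInner A τ ^ M * g → g = 0)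
    {V : Submodule k A} [FiniteDimensional k V] {M : ℕ} {T : ℤ}
    (hV : V ≤ Fil.carrier (T - δ * M - n)) [FiniteDimensional k (Fil.carrier T)] {D L : ℕ}
    (hL : D + L = M)
    (hdim : F.natDegree * L * Module.finrank k (Fil.carrier T) < M * n * Module.finrank k V) :
    ∃ Θ G K : A[X][X], ∃ γ : ℕ → A[X][X], Θ ≠ 0 ∧ Θ ∈ Fil.poly.poly.carrier T ∧
      (∀ e c, F.natDegree ≤ e ∨ D ≤ c → (Θ.coeff e).coeff c = 0) ∧
      Θ = ∑ j ∈ Finset.range M, τ ^ (j + 1) * C X ^ (M - 1 - j) * γ j + C X ^ M * G + F * K := by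
  classical
  let Φ : (Fin M → Fin n → V) →ₗ[k] (Fin F.natDegree → Fin L → Fil.carrier T) :=
    { toFun := fun c e l => ⟨((auxCombination τ V M n c %ₘ F).coeff e).coeff (D + l), by
        have h := (DegFil.divByMonic_modByMonic_mem _ hF rfl hFm _ _
          (auxCombination_mem hδ hτ hV c)).2 e (D + l)
        exact Fil.mono (by omega) h⟩
      map_add' := fun c c' => by
        funext e l
        apply Subtype.ext
        simp [add_modByMonic]
      map_smul' := fun r c => by
        funext e l
        apply Subtype.ext
        have h := LinearMap.map_smul_of_tower (modByMonicHom F) r (auxCombination τ V M n c)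
        simp only [modByMonicHom_apply] at h
        simp [h] }
  have hker : LinearMap.ker Φ ≠ ⊥ := by
    apply LinearMap.ker_ne_bot_of_finrank_lt
    simp only [Module.finrank_pi_fintype, Finset.sum_const, Finset.card_univ, Fintype.card_fin,
      smul_eq_mul]
    simpa only [mul_assoc] using hdim
  obtain ⟨c, hc, hc0⟩ := (Submodule.ne_bot_iff _).1 hker
  rw [LinearMap.mem_ker] at hc
  set S := auxCombination τ V M n c with hS
  set r := S %ₘ F with hr
  have hrmem : r ∈ Fil.poly.poly.carrier T :=
    (DegFil.divByMonic_modByMonic_mem _ hF rfl hFm _ _ (auxCombination_mem hδ hτ hV c)).2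
  have hrdeg : ∀ e, F.natDegree ≤ e → r.coeff e = 0 := fun e he => by
    apply coeff_eq_zero_of_degree_lt
    refine (degree_modByMonic_lt _ hF).trans_le ?_
    rw [degree_eq_natDegree hF.ne_zero]
    exact_mod_cast he
  have hrzero : ∀ e c, D ≤ c → c < M → (r.coeff e).coeff c = 0 := fun e c h1 h2 => by
    by_cases he : e < F.natDegree
    · have := congrArg Subtype.val (congrFun (congrFun hc ⟨e, he⟩) ⟨c - D, by omega⟩)
      have e1 : D + (c - D) = c := by omega
      simpa [Φ, e1] using this
    · rw [hrdeg e (by omega), coeff_zero]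
  let Θ : A[X][X] := ∑ e ∈ Finset.range F.natDegree,
    C (∑ c ∈ Finset.range D, C ((r.coeff e).coeff c) * X ^ c) * X ^ e
  have hΘ : ∀ e c, (Θ.coeff e).coeff c = if e < F.natDegree ∧ c < D then (r.coeff e).coeff c
      else 0 := fun e c => by
    simp only [Θ, finsetSum_coeff, coeff_C_mul, coeff_X_pow, mul_ite, mul_one, mul_zero,
      Finset.sum_ite_eq, Finset.mem_range, ite_and]
    split_ifs with h1 h2 <;>
    simp [coeff_X_pow] <;> omega
  obtain ⟨G, hG⟩ : C X ^ M ∣ Θ - r := by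
    rw [← C_pow, C_dvd_iff_dvd_coeff]
    intro e
    rw [X_pow_dvd_iff]
    intro c hcM
    rw [coeff_sub, coeff_sub, hΘ]
    split_ifs with h
    · simp
    · by_cases he : e < F.natDegree
      · rw [hrzero e c (by by_contra h'; exact h ⟨he, by omega⟩) hcM, sub_zero]
      · rw [hrdeg e (by omega)]; simp
  have hSr := modByMonic_add_div S F
  set γ : ℕ → A[X] := fun j =>
    if h : j < M then ∑ i : Fin n, C (c ⟨j, h⟩ i : A) * X ^ (i : ℕ) else 0 with hγ
  have hγdeg : ∀ j, (γ j).degree < n := fun j => by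
    simp only [hγ]
    split_ifs with h
    · exact degree_sum_fin_lt _
    · rw [degree_zero]; exact WithBot.bot_lt_coe _
  have hSγ : S = ∑ j ∈ Finset.range M, τ ^ (j + 1) * C X ^ (M - 1 - j) * (γ j).map C :=
    auxCombination_eq τ V M n c
  refine ⟨Θ, G, -(S /ₘ F), fun j => (γ j).map C, ?_, ?_, ?_, ?_⟩
  · intro h0
    apply hc0
    have key := coeffs_eq_zero_of_sum_eq hF H M γ hγdeg (-G) (S /ₘ F) (by
      rw [← hSγ]
      rw [h0, zero_sub] at hG
      linear_combination -hG - hSr)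
    funext j i
    apply Subtype.ext
    have h1 := key j j.2
    simp only [hγ, j.2, dif_pos] at h1
    have h2 := congrArg (coeff · (i : ℕ)) h1
    simpa [finsetSum_coeff, coeff_X_pow, Fin.val_inj] using h2
  · intro e c
    rw [hΘ]
    split_ifs
    · exact hrmem e c
    · exact zero_mem _
  · intro e c h
    rw [hΘ, if_neg (by omega)]
  · rw [← hSγ]
    linear_combination hG + hSr

end Auxiliary

section InnerDerivative

variable {R : Type*} [CommRing R]

/-- The derivative of a bivariate polynomial with respect to its inner variable. -/
noncomputable def innerDerivative (G : R[X][X]) : R[X][X] :=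
  Bivariate.swap (derivative (Bivariate.swap G))

theorem coeff_innerDerivative (G : R[X][X]) (i : ℕ) :
    (innerDerivative G).coeff i = derivative (G.coeff i) := by
  induction G using Polynomial.induction_on' with
  | add p q hp hq => simp only [innerDerivative, map_add, coeff_add] at hp hq ⊢; rw [hp, hq]
  | monomial n a =>
    have h : innerDerivative (monomial n a) = monomial n (derivative a) := by
      rw [innerDerivative, Bivariate.swap_monomial, derivative_mul, derivative_C, mul_zero,
        add_zero, derivative_map, map_mul, Bivariate.swap_map_C, Bivariate.swap_C,
        Polynomial.map_pow, map_X, C_mul_X_pow_eq_monomial]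
    rw [h, coeff_monomial, coeff_monomial]
    split_ifs <;> simp

theorem innerDerivative_add (G H : R[X][X]) :
    innerDerivative (G + H) = innerDerivative G + innerDerivative H := by
  simp [innerDerivative]

theorem innerDerivative_mul (G H : R[X][X]) :
    innerDerivative (G * H) = innerDerivative G * H + G * innerDerivative H := by
  simp only [innerDerivative, map_mul, derivative_mul, map_add, Bivariate.swap_swap_apply]

theorem DegFil.innerDerivative_mem {k : Type*} [Field k] [Algebra k R] {F : DegFil k R} {n : ℤ}
    {G : R[X][X]} (h : G ∈ F.poly.poly.carrier n) :
    innerDerivative G ∈ F.poly.poly.carrier (n - 1) := by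
  intro i j
  rw [coeff_innerDerivative, coeff_derivative]
  have h1 := h i (j + 1)
  have h2 : (G.coeff i).coeff (j + 1) * ((j : R) + 1) =
      ((j : k) + 1) • (G.coeff i).coeff (j + 1) := by
    rw [Algebra.smul_def, mul_comm]; simp
  rw [h2]
  refine Submodule.smul_mem _ _ (F.mono ?_ h1)
  push_cast
  omega

end InnerDerivative

/-- The hypotheses on an equation `f(x, y) = 0` of an affine plane curve: monic in `y`, with total
degree equal to its degree in `y`, and irreducible. -/
structure IsPlaneCurve {k : Type*} [Field k] (f : k[X][X]) : Prop where
  monic : f.Monic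
  mem : f ∈ (DegFil.triv k k).poly.poly.carrier f.natDegree
  irreducible : Irreducible f

namespace PlaneCurve

variable {k : Type*} [Field k] {f : k[X][X]}

/-- The quotient map to the coordinate ring as a morphism of algebras over the base field. -/
noncomputable def coord (f : k[X][X]) : k[X][X] →ₐ[k] AdjoinRoot f :=
  (AdjoinRoot.mkₐ f).restrictScalars k

theorem coord_apply (G : k[X][X]) : coord f G = AdjoinRoot.mk f G := rfl

/-- The filtration of the coordinate ring by degree. -/
noncomputable def fil (f : k[X][X]) : DegFil k (AdjoinRoot f) :=
  (DegFil.triv k k).poly.poly.map (coord f)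

theorem mk_mem_fil {n : ℤ} {G : k[X][X]} (h : G ∈ (DegFil.triv k k).poly.poly.carrier n) :
    AdjoinRoot.mk f G ∈ (fil f).carrier n := ⟨G, h, rfl⟩

theorem root_mem_fil : AdjoinRoot.root f ∈ (fil f).carrier 1 := by
  rw [← AdjoinRoot.mk_X]
  exact mk_mem_fil (DegFil.X_mem_poly _)

theorem of_X_mem_fil : AdjoinRoot.of f X ∈ (fil f).carrier 1 :=
  mk_mem_fil (DegFil.C_mem_poly (DegFil.X_mem_poly _))

theorem isDomain (hf : IsPlaneCurve f) : IsDomain (AdjoinRoot f) :=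
  AdjoinRoot.isDomain_of_prime hf.irreducible.prime

/-- The basis of monomials `x ^ i * y ^ j`, `j < natDegree f`, of the coordinate ring. -/
noncomputable def monomialBasis (hf : IsPlaneCurve f) :
    Module.Basis (ℕ × Fin f.natDegree) k (AdjoinRoot f) :=
  (basisMonomials k).smulTower (AdjoinRoot.powerBasisAux' hf.monic)

theorem monomialBasis_mem (hf : IsPlaneCurve f) (i : ℕ × Fin f.natDegree) :
    monomialBasis hf i ∈ (fil f).carrier (i.1 + f.natDegree) := by
  rw [monomialBasis, Module.Basis.smulTower_apply, AdjoinRoot.powerBasisAux'_apply,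
    Algebra.smul_def, AdjoinRoot.algebraMap_eq, coe_basisMonomials]
  simp only [monomial_one_right_eq_X_pow, map_pow]
  refine DegFil.mono _ ?_ (DegFil.mul_mem _ (DegFil.pow_mem _ of_X_mem_fil _)
    (DegFil.pow_mem _ root_mem_fil _))
  have := i.2.2
  omega

theorem monomialBasis_repr_eq_zero (hf : IsPlaneCurve f) {m : ℕ} {x : AdjoinRoot f}
    (hx : x ∈ (fil f).carrier m) {i : ℕ × Fin f.natDegree} (hi : m < i.1) :
    (monomialBasis hf).repr x i = 0 := by
  obtain ⟨G, hG, rfl⟩ := hx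
  rw [monomialBasis, Module.Basis.smulTower_repr, AdjoinRoot.powerBasisAux'_repr_apply_to_fun]
  have h := (DegFil.divByMonic_modByMonic_mem _ hf.monic rfl hf.mem _ _ hG).2 i.2 i.1
  exact DegFil.eq_zero_of_mem_triv (by omega) h

/-- The span of the monomials `x ^ i * y ^ j` with `i < n` and `j < natDegree f`. -/
noncomputable def monomialSpan (hf : IsPlaneCurve f) (n : ℕ) : Submodule k (AdjoinRoot f) :=
  Submodule.span k (Set.range fun i : Fin n × Fin f.natDegree => monomialBasis hf (i.1, i.2))

instance (hf : IsPlaneCurve f) (n : ℕ) : FiniteDimensional k (monomialSpan hf n) :=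
  FiniteDimensional.span_of_finite k (Set.finite_range _)

theorem finrank_monomialSpan (hf : IsPlaneCurve f) (n : ℕ) :
    Module.finrank k (monomialSpan hf n) = n * f.natDegree := by
  rw [monomialSpan, finrank_span_eq_card]
  · simp
  · refine (monomialBasis hf).linearIndependent.comp
      (fun i : Fin n × Fin f.natDegree => ((i.1 : ℕ), i.2)) ?_
    rintro ⟨a, b⟩ ⟨c, e⟩ h
    simpa [Fin.val_inj] using h

theorem monomialSpan_le (hf : IsPlaneCurve f) (n : ℕ) :
    monomialSpan hf n ≤ (fil f).carrier (n + f.natDegree) := by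
  rw [monomialSpan, Submodule.span_le]
  rintro _ ⟨i, rfl⟩
  refine DegFil.mono _ ?_ (monomialBasis_mem hf _)
  have := i.1.2
  simp only
  omega

theorem fil_le_monomialSpan (hf : IsPlaneCurve f) (m : ℕ) :
    (fil f).carrier m ≤ monomialSpan hf (m + 1) := by
  intro x hx
  rw [← (monomialBasis hf).linearCombination_repr x, Finsupp.linearCombination_apply]
  refine sum_mem fun i hi => Submodule.smul_mem _ _ (Submodule.subset_span ?_)
  have : ¬ m < i.1 := fun h => (Finsupp.mem_support_iff.1 hi) (monomialBasis_repr_eq_zero hf hx h)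
  exact ⟨(⟨i.1, by omega⟩, i.2), rfl⟩

theorem finiteDimensional_fil (hf : IsPlaneCurve f) (m : ℕ) :
    FiniteDimensional k ((fil f).carrier m) :=
  Submodule.finiteDimensional_of_le (fil_le_monomialSpan hf m)

theorem finrank_fil_le (hf : IsPlaneCurve f) (m : ℕ) :
    Module.finrank k ((fil f).carrier m) ≤ (m + 1) * f.natDegree := by
  rw [← finrank_monomialSpan hf]
  exact Submodule.finrank_mono (fil_le_monomialSpan hf m)

theorem mk_derivative_ne_zero (hf : IsPlaneCurve f) (hd : (f.natDegree : k) ≠ 0) :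
    AdjoinRoot.mk f (derivative f) ≠ 0 := by
  have hd0 : f.natDegree ≠ 0 := by rintro h; simp [h] at hd
  refine AdjoinRoot.mk_ne_zero_of_natDegree_lt hf.monic (fun h => hd ?_)
    (natDegree_derivative_lt hd0)
  have h1 := congrArg (coeff · (f.natDegree - 1)) h
  simp only [coeff_derivative, coeff_zero] at h1
  rw [show f.natDegree - 1 + 1 = f.natDegree by omega, hf.monic.coeff_natDegree, one_mul] at h1
  have h2 : ((f.natDegree : k[X])) = 0 := by
    rw [← h1]
    have : ((f.natDegree - 1 + 1 : ℕ) : k[X]) = (f.natDegree - 1 : ℕ) + 1 := by push_cast; ring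
    rw [← this, show f.natDegree - 1 + 1 = f.natDegree by omega]
  have h3 := congrArg (coeff · 0) h2
  simpa using h3

theorem mk_innerDerivative_ne_zero [IsAlgClosed k] (hf : IsPlaneCurve f) (hd : 2 ≤ f.natDegree)
    (hchar : ∀ j, 0 < j → j ≤ f.natDegree → (j : k) ≠ 0) :
    AdjoinRoot.mk f (innerDerivative f) ≠ 0 := by
  intro h0
  have hzero : innerDerivative f = 0 := by
    by_contra hne
    refine AdjoinRoot.mk_ne_zero_of_natDegree_lt hf.monic hne ?_ h0
    rw [natDegree_lt_iff_degree_lt hne, degree_lt_iff_coeff_zero]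
    intro m hm
    rw [coeff_innerDerivative]
    rcases hm.eq_or_lt with rfl | hm
    · rw [hf.monic.coeff_natDegree, derivative_one]
    · rw [coeff_eq_zero_of_natDegree_lt hm, derivative_zero]
  have hconst : (f.map constantCoeff).map C = f := by
    ext i j
    rw [coeff_map, coeff_map, coeff_C]
    split_ifs with hj
    · simp [hj]
    symm
    by_cases hjd : j ≤ f.natDegree
    · have h1 := congrArg (fun G : k[X][X] => (G.coeff i).coeff (j - 1)) hzero
      simp only [coeff_innerDerivative, coeff_derivative, coeff_zero] at h1
      rw [show j - 1 + 1 = j by omega] at h1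
      refine (mul_eq_zero.1 h1).resolve_right ?_
      have := hchar j (by omega) hjd
      rwa [show ((j - 1 : ℕ) : k) + 1 = ((j - 1 + 1 : ℕ) : k) by push_cast; ring,
        show j - 1 + 1 = j by omega]
    · exact DegFil.eq_zero_of_mem_triv (by omega) (hf.mem i j)
  set g := f.map constantCoeff with hg
  have hgm : g.Monic := hf.monic.map _
  have hgd : g.natDegree = f.natDegree := hf.monic.natDegree_map _
  obtain ⟨c, hc⟩ := IsAlgClosed.exists_root g (by
    rw [degree_eq_natDegree hgm.ne_zero, hgd]
    have : f.natDegree ≠ 0 := by omega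
    exact_mod_cast this)
  obtain ⟨q, hq⟩ := dvd_iff_isRoot.2 hc
  have hfq : f = (X - C c).map C * q.map C := by rw [← Polynomial.map_mul, ← hq, hconst]
  have hq0 : q ≠ 0 := by rintro rfl; exact hgm.ne_zero (by rw [hq, mul_zero])
  have hqd : g.natDegree = 1 + q.natDegree := by
    rw [hq, natDegree_mul (X_sub_C_ne_zero c) hq0, natDegree_X_sub_C]
  rcases hf.irreducible.isUnit_or_isUnit hfq with h | h
  · have := natDegree_eq_zero_of_isUnit h
    rw [(monic_X_sub_C c).natDegree_map, natDegree_X_sub_C] at this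
    omega
  · have := natDegree_eq_zero_of_isUnit h
    rw [natDegree_map_eq_of_injective C_injective] at this
    omega

end PlaneCurve

theorem DegFil.taylor_mem {k R : Type*} [Field k] [CommRing R] [Algebra k R] {F : DegFil k R}
    {r : R} (hr : r ∈ F.carrier 1) {n : ℤ} {q : R[X]} (hq : q ∈ F.poly.carrier n) :
    taylor r q ∈ F.poly.carrier n := by
  rw [q.as_sum_support_C_mul_X_pow, map_sum]
  refine sum_mem fun j _ => ?_
  rw [taylor_mul, taylor_C, taylor_X_pow]
  have h := DegFil.mul_mem _ (DegFil.C_mem_poly (hq j)) (DegFil.pow_mem _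
    (add_mem (DegFil.X_mem_poly F) (DegFil.C_mem_poly hr)) j)
  convert h using 2
  ring

namespace PlaneCurve

section

variable {k : Type*} [Field k]

/-- The morphism `k[X] → A[W]` sending `X` to `x + W`, where `A` is the coordinate ring. -/
noncomputable def shift (f : k[X][X]) : k[X] →+* (AdjoinRoot f)[X] :=
  (taylorAlgHom (AdjoinRoot.of f X) : (AdjoinRoot f)[X] →+* (AdjoinRoot f)[X]).comp
    (mapRingHom (algebraMap k (AdjoinRoot f)))

/-- The polynomial `f(x + W, Y)` over the coordinate ring. -/
noncomputable def shifted (f : k[X][X]) : (AdjoinRoot f)[X][X] := f.map (shift f)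

variable {f : k[X][X]}

theorem shift_apply (P : k[X]) :
    shift f P = taylor (AdjoinRoot.of f X) (P.map (algebraMap k (AdjoinRoot f))) := rfl

theorem aeval_of_X (P : k[X]) : aeval (AdjoinRoot.of f X) P = AdjoinRoot.of f P := by
  have h := aeval_algHom_apply (Algebra.ofId k[X] (AdjoinRoot f) |>.restrictScalars k) X P
  simp only [aeval_X_left_apply] at h
  exact h

theorem coeff_zero_shift (P : k[X]) : (shift f P).coeff 0 = AdjoinRoot.of f P := by
  rw [shift_apply, taylor_coeff_zero, eval_map_algebraMap, aeval_of_X]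

theorem coeff_one_shift (P : k[X]) :
    (shift f P).coeff 1 = AdjoinRoot.of f (derivative P) := by
  rw [shift_apply, taylor_coeff_one, derivative_map, eval_map_algebraMap, aeval_of_X]

theorem eval_shift (w : AdjoinRoot f) (P : k[X]) :
    (shift f P).eval w = aeval (w + AdjoinRoot.of f X) P := by
  rw [shift_apply, taylor_eval, eval_map_algebraMap]

theorem shift_mem {n : ℤ} {P : k[X]} (hP : P ∈ (DegFil.triv k k).poly.carrier n) :
    shift f P ∈ (fil f).poly.carrier n := by
  rw [shift_apply]
  refine DegFil.taylor_mem of_X_mem_fil fun i => ?_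
  rw [coeff_map]
  exact mk_mem_fil (DegFil.C_mem_poly (DegFil.C_mem_poly (hP i)))

theorem shifted_mem (hf : IsPlaneCurve f) :
    shifted f ∈ (fil f).poly.poly.carrier f.natDegree := fun i => by
  rw [shifted, coeff_map]
  exact shift_mem (hf.mem i)

theorem shifted_monic (hf : IsPlaneCurve f) : (shifted f).Monic := hf.monic.map _

theorem natDegree_shifted (hf : IsPlaneCurve f) : (shifted f).natDegree = f.natDegree := by
  have := isDomain hf
  exact hf.monic.natDegree_map _

theorem reduceInner_shifted : reduceInner _ (shifted f) = f.map (AdjoinRoot.of f) := by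
  ext i
  simp [reduceInner, shifted, coeff_zero_shift]

theorem coeff_zero_eval_map_shift (G : k[X][X]) :
    ((G.map (shift f)).eval (C (AdjoinRoot.root f))).coeff 0 = AdjoinRoot.mk f G := by
  induction G using Polynomial.induction_on' with
  | add p q hp hq => simp [hp, hq]
  | monomial n a =>
    rw [map_monomial, eval_monomial, ← C_pow, coeff_mul_C, coeff_zero_shift,
      ← C_mul_X_pow_eq_monomial, map_mul, map_pow, AdjoinRoot.mk_X, AdjoinRoot.mk_C]

theorem coeff_one_eval_map_shift (G : k[X][X]) :
    ((G.map (shift f)).eval (C (AdjoinRoot.root f))).coeff 1 =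
      AdjoinRoot.mk f (innerDerivative G) := by
  induction G using Polynomial.induction_on' with
  | add p q hp hq => simp [hp, hq, innerDerivative_add]
  | monomial n a =>
    have h : innerDerivative (monomial n a) = C (derivative a) * X ^ n := by
      ext1 i
      rw [coeff_innerDerivative, coeff_monomial, coeff_C_mul_X_pow]
      split_ifs with h1 h2 h2
      · rfl
      · exact absurd h1.symm h2
      · exact absurd h2.symm h1
      · simp
    rw [h, map_monomial, eval_monomial, ← C_pow, coeff_mul_C, coeff_one_shift, map_mul, map_pow,
      AdjoinRoot.mk_X, AdjoinRoot.mk_C]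

/-- The linear factor `Y - y` over the coordinate ring. -/
noncomputable def linearFactor (f : k[X][X]) : (AdjoinRoot f)[X][X] :=
  X - C (C (AdjoinRoot.root f))

/-- The quotient of `f(x + W, Y)` by `Y - y`. -/
noncomputable def cofactor (f : k[X][X]) : (AdjoinRoot f)[X][X] := shifted f /ₘ linearFactor f

/-- The polynomial `f(x + W, y) / W`. -/
noncomputable def slope (f : k[X][X]) : (AdjoinRoot f)[X] :=
  ((shifted f).eval (C (AdjoinRoot.root f))).divX

theorem shifted_eq (f : k[X][X]) :
    shifted f = linearFactor f * cofactor f + C (X * slope f) := by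
  have h1 := modByMonic_add_div (shifted f) (linearFactor f)
  rw [linearFactor, modByMonic_X_sub_C_eq_C_eval] at h1
  have h2 := X_mul_divX_add ((shifted f).eval (C (AdjoinRoot.root f)))
  rw [shifted, coeff_zero_eval_map_shift, AdjoinRoot.mk_self, C_0, add_zero, ← shifted] at h2
  rw [slope, h2, add_comm, cofactor, linearFactor]
  exact h1.symm

theorem slope_coeff_zero : (slope f).coeff 0 = AdjoinRoot.mk f (innerDerivative f) := by
  rw [slope, coeff_divX]
  exact coeff_one_eval_map_shift f

theorem linearFactor_monic (f : k[X][X]) : (linearFactor f).Monic := monic_X_sub_C _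

theorem linearFactor_mem : linearFactor f ∈ (fil f).poly.poly.carrier 1 :=
  sub_mem (DegFil.X_mem_poly _) (DegFil.C_mem_poly (DegFil.C_mem_poly root_mem_fil))

theorem cofactor_mem (hf : IsPlaneCurve f) :
    cofactor f ∈ (fil f).poly.poly.carrier (f.natDegree - 1) := by
  have := isDomain hf
  exact_mod_cast (DegFil.divByMonic_modByMonic_mem _ (linearFactor_monic f) (natDegree_X_sub_C _)
    (by exact_mod_cast linearFactor_mem) _ _ (shifted_mem hf)).1

theorem reduceInner_linearFactor :
    reduceInner _ (linearFactor f) = X - C (AdjoinRoot.root f) := by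
  simp [reduceInner, linearFactor]

theorem map_of_eq :
    f.map (AdjoinRoot.of f) = (X - C (AdjoinRoot.root f)) * reduceInner _ (cofactor f) := by
  rw [← reduceInner_shifted, shifted_eq, map_add, map_mul, reduceInner_linearFactor, C_mul,
    map_mul, reduceInner_C_X, zero_mul, add_zero]

theorem eval_cofactor :
    (reduceInner _ (cofactor f)).eval (AdjoinRoot.root f) = AdjoinRoot.mk f (derivative f) := by
  have h := congrArg (fun g => (derivative g).eval (AdjoinRoot.root f)) (map_of_eq (f := f))
  simp only [derivative_mul, derivative_map, derivative_sub, derivative_X, derivative_C, sub_zero,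
    one_mul, eval_add, eval_mul, eval_sub, eval_X, eval_C, sub_self, zero_mul, add_zero] at h
  rw [← h, eval_map, ← AdjoinRoot.aeval_eq, aeval_def, AdjoinRoot.algebraMap_eq]

theorem cofactor_monic_and_degree (hf : IsPlaneCurve f) :
    (reduceInner _ (cofactor f)).Monic ∧
      (reduceInner _ (cofactor f)).natDegree + 1 = f.natDegree := by
  have := isDomain hf
  have h1 : (f.map (AdjoinRoot.of f)).Monic := hf.monic.map _
  rw [map_of_eq] at h1
  have h2 := (monic_X_sub_C (AdjoinRoot.root f)).of_mul_monic_left h1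
  refine ⟨h2, ?_⟩
  rw [← hf.monic.natDegree_map (AdjoinRoot.of f), map_of_eq, Monic.natDegree_mul
    (monic_X_sub_C _) h2, natDegree_X_sub_C, add_comm]

theorem eq_zero_of_dvd_linearFactor_pow_mul (hf : IsPlaneCurve f) (hd : (f.natDegree : k) ≠ 0)
    (M : ℕ) (g : (AdjoinRoot f)[X]) (hg : g.degree < (f.natDegree - 1 : ℕ))
    (h : reduceInner _ (shifted f) ∣ reduceInner _ (linearFactor f) ^ M * g) : g = 0 := by
  have := isDomain hf
  obtain ⟨hm, hdeg⟩ := cofactor_monic_and_degree hf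
  rw [reduceInner_shifted, map_of_eq, reduceInner_linearFactor] at h
  replace h := (dvd_mul_left _ _).trans h
  set c := reduceInner _ (cofactor f) with hc
  have hdvd : c ∣ g := by
    induction M with
    | zero => simpa using h
    | succ M ih =>
      refine ih ?_
      obtain ⟨q, hq⟩ := h
      have h1 := congrArg (eval (AdjoinRoot.root f)) hq
      rw [pow_succ', mul_assoc, eval_mul, eval_sub, eval_X, eval_C, sub_self, zero_mul, eval_mul,
        hc, eval_cofactor] at h1
      have h2 := (mul_eq_zero.1 h1.symm).resolve_left (mk_derivative_ne_zero hf hd)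
      obtain ⟨q', rfl⟩ := dvd_iff_isRoot.2 h2
      refine ⟨q', mul_left_cancel₀ (X_sub_C_ne_zero (AdjoinRoot.root f)) ?_⟩
      rw [pow_succ'] at hq
      linear_combination hq
  by_contra hg0
  refine hm.not_dvd_of_degree_lt hg0 ?_ hdvd
  rw [degree_eq_natDegree hm.ne_zero]
  convert hg using 2
  omega

theorem eq_zero_of_dvd_cofactor_pow_mul (hf : IsPlaneCurve f) (hd : (f.natDegree : k) ≠ 0)
    (M : ℕ) (g : (AdjoinRoot f)[X]) (hg : g.degree < (1 : ℕ))
    (h : reduceInner _ (shifted f) ∣ reduceInner _ (cofactor f) ^ M * g) : g = 0 := by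
  have := isDomain hf
  rw [reduceInner_shifted, map_of_eq] at h
  obtain ⟨q, hq⟩ := h
  have hgC : g = C (g.coeff 0) := eq_C_of_natDegree_le_zero <|
    natDegree_le_iff_coeff_eq_zero.2 fun i hi => (degree_lt_iff_coeff_zero _ _).1 hg i hi
  rw [hgC] at hq ⊢
  have h1 := congrArg (eval (AdjoinRoot.root f)) hq
  rw [eval_mul, eval_pow, eval_cofactor, eval_C, eval_mul, eval_mul, eval_sub, eval_X, eval_C,
    sub_self, zero_mul, zero_mul] at h1
  rw [(mul_eq_zero.1 h1).resolve_left (pow_ne_zero _ (mk_derivative_ne_zero hf hd)), C_0]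

end

end PlaneCurve

namespace PlaneCurve

variable {k : Type*} [Field k] {f : k[X][X]}

theorem exists_ringHom_ne_zero [IsAlgClosed k] (hf : IsPlaneCurve f) (hd : f.natDegree ≠ 0)
    {a : AdjoinRoot f} (ha : a ≠ 0) :
    ∃ ρ : AdjoinRoot f →+* k, ρ.comp (algebraMap k (AdjoinRoot f)) = RingHom.id k ∧ ρ a ≠ 0 := by
  have := isDomain hf
  have : Infinite k := IsAlgClosed.instInfinite
  obtain ⟨x₀, hx₀⟩ := exists_eval_ne_zero_of_natDegree_lt_card (Algebra.norm k[X] a)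
    (AdjoinRoot.norm_ne_zero hf.monic ha) ((Cardinal.natCast_lt_aleph0).trans_le
      (Cardinal.infinite_iff.1 this))
  obtain ⟨y₀, hy₀⟩ := IsAlgClosed.exists_root (f.map (evalRingHom x₀)) (by
    rw [degree_eq_natDegree (hf.monic.map _).ne_zero, hf.monic.natDegree_map]
    exact_mod_cast hd)
  rw [IsRoot, eval_map] at hy₀
  refine ⟨AdjoinRoot.lift (evalRingHom x₀) y₀ hy₀, ?_, fun h => hx₀ ?_⟩
  · ext c
    rw [RingHom.comp_apply, IsScalarTower.algebraMap_apply k k[X] (AdjoinRoot f),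
      AdjoinRoot.algebraMap_eq, AdjoinRoot.lift_of]
    simp
  · obtain ⟨b, hb⟩ := AdjoinRoot.dvd_of_norm hf.monic a
    have h1 := congrArg (AdjoinRoot.lift (evalRingHom x₀) y₀ hy₀) hb
    rwa [AdjoinRoot.lift_of, map_mul, h, zero_mul] at h1

/-- The equation of the curve, viewed over its own coordinate ring. -/
noncomputable def selfBaseChange (f : k[X][X]) : (AdjoinRoot f)[X][X] :=
  f.map (mapRingHom (algebraMap k (AdjoinRoot f)))

theorem selfBaseChange_monic (hf : IsPlaneCurve f) : (selfBaseChange f).Monic := hf.monic.map _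

theorem natDegree_selfBaseChange (hf : IsPlaneCurve f) :
    (selfBaseChange f).natDegree = f.natDegree := by
  have := isDomain hf
  exact hf.monic.natDegree_map _

theorem exists_coeff_ne_zero {R : Type*} [CommRing R] [Nontrivial R] {g : R[X][X]} (hg : g.Monic)
    {x : AdjoinRoot g} (hx : x ≠ 0) :
    ∃ G : R[X][X], AdjoinRoot.mk g G = x ∧ G.degree < g.degree ∧
      ∃ i j, (G.coeff i).coeff j ≠ 0 := by
  obtain ⟨G, rfl⟩ := AdjoinRoot.mk_surjective x
  have hmk : AdjoinRoot.mk g (G %ₘ g) = AdjoinRoot.mk g G := by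
    rw [AdjoinRoot.mk_eq_mk, modByMonic_eq_sub_mul_div]
    exact ⟨-(G /ₘ g), by ring⟩
  refine ⟨G %ₘ g, hmk, degree_modByMonic_lt _ hg, ?_⟩
  by_contra! h
  apply hx
  rw [← hmk, show G %ₘ g = 0 from Polynomial.ext fun i => Polynomial.ext fun j => by simp [h],
    map_zero]

theorem selfBaseChange_isDomain [IsAlgClosed k] (hf : IsPlaneCurve f) (hd : f.natDegree ≠ 0) :
    IsDomain (AdjoinRoot (selfBaseChange f)) := by
  have := isDomain hf
  have hm := selfBaseChange_monic hf
  have hnt : Nontrivial (AdjoinRoot (selfBaseChange f)) := by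
    refine ⟨1, 0, ?_⟩
    rw [← map_one (AdjoinRoot.mk (selfBaseChange f))]
    refine AdjoinRoot.mk_ne_zero_of_natDegree_lt hm one_ne_zero ?_
    rw [natDegree_one, natDegree_selfBaseChange hf]
    omega
  refine @NoZeroDivisors.to_isDomain _ _ hnt ⟨fun {a b} hab => ?_⟩
  by_contra! hne
  obtain ⟨G, rfl, hGd, i, j, hG⟩ := exists_coeff_ne_zero hm hne.1
  obtain ⟨H, rfl, hHd, i', j', hH⟩ := exists_coeff_ne_zero hm hne.2
  obtain ⟨ρ, hρ, hρ0⟩ := exists_ringHom_ne_zero hf hd (mul_ne_zero hG hH)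
  rw [map_mul] at hρ0
  have hdvd : f ∣ (selfBaseChange f).map (mapRingHom ρ) := by
    rw [selfBaseChange, Polynomial.map_map, mapRingHom_comp, hρ, mapRingHom_id, Polynomial.map_id]
  have key : ∀ G : (AdjoinRoot f)[X][X], G.degree < (selfBaseChange f).degree → ∀ i j,
      ρ ((G.coeff i).coeff j) ≠ 0 → AdjoinRoot.mk f (G.map (mapRingHom ρ)) ≠ 0 := by
    intro G hG i j h
    refine AdjoinRoot.mk_ne_zero_of_degree_lt hf.monic (fun h0 => h ?_) ?_
    · have := congrArg (fun g : k[X][X] => (g.coeff i).coeff j) h0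
      simpa using this
    · refine degree_map_le.trans_lt (hG.trans_eq ?_)
      exact hf.monic.degree_map _
  have h1 := congrArg (AdjoinRoot.map (mapRingHom ρ) _ f hdvd) hab
  rw [map_mul, map_zero, AdjoinRoot.map, AdjoinRoot.lift_mk, AdjoinRoot.lift_mk] at h1
  have h2 : ∀ G : (AdjoinRoot f)[X][X],
      eval₂ ((AdjoinRoot.of f).comp (mapRingHom ρ)) (AdjoinRoot.root f) G =
        AdjoinRoot.mk f (G.map (mapRingHom ρ)) := fun G => by
    rw [← AdjoinRoot.aeval_eq, aeval_def, AdjoinRoot.algebraMap_eq, eval₂_map]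
  rw [h2, h2] at h1
  rcases mul_eq_zero.1 h1 with h | h
  · exact key G hGd i j (left_ne_zero_of_mul hρ0) h
  · exact key H hHd i' j' (right_ne_zero_of_mul hρ0) h

section Derivation

/-- The Hamiltonian vector field `f_y ∂/∂x - f_x ∂/∂y` before passing to the quotient. -/
noncomputable def preDerivation (f : k[X][X]) : k[X][X] →ₗ[k] AdjoinRoot f where
  toFun G := AdjoinRoot.mk f (derivative f * innerDerivative G - innerDerivative f * derivative G)
  map_add' G H := by rw [← map_add]; congr 1; rw [innerDerivative_add, derivative_add]; ring
  map_smul' c G := by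
    have h : innerDerivative (c • G) = c • innerDerivative G := by
      simp [innerDerivative]
    rw [h, derivative_smul, mul_smul_comm, mul_smul_comm, ← smul_sub, RingHom.id_apply,
      ← coord_apply, ← coord_apply, map_smul]

theorem preDerivation_apply (G : k[X][X]) : preDerivation f G =
    AdjoinRoot.mk f (derivative f) * AdjoinRoot.mk f (innerDerivative G) -
      AdjoinRoot.mk f (innerDerivative f) * AdjoinRoot.mk f (derivative G) := by
  rw [← map_mul, ← map_mul, ← map_sub]
  rfl

theorem preDerivation_mul (G H : k[X][X]) : preDerivation f (G * H) =
    AdjoinRoot.mk f G * preDerivation f H + AdjoinRoot.mk f H * preDerivation f G := by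
  simp only [preDerivation_apply, innerDerivative_mul, derivative_mul, map_mul, map_add]
  ring

theorem preDerivation_self_mul (G : k[X][X]) : preDerivation f (f * G) = 0 := by
  rw [preDerivation_mul, AdjoinRoot.mk_self, zero_mul, zero_add]
  rw [preDerivation_apply, mul_comm (AdjoinRoot.mk f (derivative f)), sub_self, mul_zero]

theorem preDerivation_modByMonic (G : k[X][X]) :
    preDerivation f (G %ₘ f) = preDerivation f G := by
  rw [modByMonic_eq_sub_mul_div, map_sub, preDerivation_self_mul, sub_zero]

/-- The Hamiltonian vector field `f_y ∂/∂x - f_x ∂/∂y` on the curve. -/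
noncomputable def hamiltonian (hf : IsPlaneCurve f) :
    Derivation k (AdjoinRoot f) (AdjoinRoot f) :=
  Derivation.mk' ((preDerivation f).comp ((AdjoinRoot.modByMonicHom hf.monic).restrictScalars k))
    (fun a b => by
      obtain ⟨G, rfl⟩ := AdjoinRoot.mk_surjective a
      obtain ⟨H, rfl⟩ := AdjoinRoot.mk_surjective b
      simp only [LinearMap.comp_apply, LinearMap.restrictScalars_apply, ← map_mul,
        AdjoinRoot.modByMonicHom_mk, preDerivation_modByMonic, preDerivation_mul, smul_eq_mul])

theorem hamiltonian_of_X (hf : IsPlaneCurve f) :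
    hamiltonian hf (AdjoinRoot.of f X) = AdjoinRoot.mk f (derivative f) := by
  have h : innerDerivative (C X : k[X][X]) = 1 := by
    ext1 i
    rw [coeff_innerDerivative, coeff_C, coeff_one]
    split_ifs <;> simp
  rw [← AdjoinRoot.mk_C]
  change preDerivation f (AdjoinRoot.modByMonicHom hf.monic (AdjoinRoot.mk f (C X))) = _
  rw [AdjoinRoot.modByMonicHom_mk, preDerivation_modByMonic, preDerivation_apply, h,
    derivative_C, map_one, map_zero, mul_one, mul_zero, sub_zero]

end Derivation

section Frobenius

variable {p : ℕ} [Fact p.Prime] [CharP k p]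

theorem eval₂_frobenius_eq_zero
    (hfr : f.map (mapRingHom (frobenius k p)) = f) :
    f.eval₂ (aeval (R := k) (AdjoinRoot.of f X ^ p) : k[X] →+* AdjoinRoot f)
      (AdjoinRoot.root f ^ p) = 0 := by
  have : CharP (AdjoinRoot f) p ∨ Subsingleton (AdjoinRoot f) := by
    rcases subsingleton_or_nontrivial (AdjoinRoot f) with h | h
    · exact Or.inr h
    · exact Or.inl (charP_of_injective_algebraMap (algebraMap k (AdjoinRoot f)).injective p)
  rcases this with _ | _
  swap
  · exact Subsingleton.elim _ _
  have key : (eval₂RingHom (aeval (R := k) (AdjoinRoot.of f X ^ p) : k[X] →+* AdjoinRoot f)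
      (AdjoinRoot.root f ^ p)).comp (mapRingHom (mapRingHom (frobenius k p))) =
      (frobenius (AdjoinRoot f) p).comp (AdjoinRoot.mk f) := by
    refine Polynomial.ringHom_ext' (Polynomial.ringHom_ext' (RingHom.ext fun c => ?_) ?_) ?_
    · simp only [RingHom.comp_apply, coe_mapRingHom, map_C, coe_eval₂RingHom, eval₂_C,
        RingHom.coe_coe, aeval_C, frobenius_def, map_pow]
      rfl
    · simp [frobenius_def]
    · simp [frobenius_def]
  have h := RingHom.congr_fun key f
  simp only [RingHom.comp_apply, coe_mapRingHom, hfr, AdjoinRoot.mk_self, map_zero] at h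
  exact h

/-- The relative Frobenius endomorphism `x ↦ x ^ p`, `y ↦ y ^ p` of the coordinate ring. -/
noncomputable def relFrobenius (hfr : f.map (mapRingHom (frobenius k p)) = f) :
    AdjoinRoot f →+* AdjoinRoot f :=
  AdjoinRoot.lift (aeval (R := k) (AdjoinRoot.of f X ^ p) : k[X] →+* AdjoinRoot f)
    (AdjoinRoot.root f ^ p) (eval₂_frobenius_eq_zero hfr)

variable (hfr : f.map (mapRingHom (frobenius k p)) = f)

theorem relFrobenius_of (P : k[X]) :
    relFrobenius hfr (AdjoinRoot.of f P) = AdjoinRoot.of f (expand k p P) := by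
  rw [relFrobenius, AdjoinRoot.lift_of, RingHom.coe_coe, ← aeval_of_X (expand k p P), expand_aeval]

theorem relFrobenius_root :
    relFrobenius hfr (AdjoinRoot.root f) = AdjoinRoot.root f ^ p := by
  rw [relFrobenius, AdjoinRoot.lift_root]

theorem relFrobenius_injective (hf : IsPlaneCurve f) (hd : f.natDegree ≠ 0) :
    Function.Injective (relFrobenius hfr) := by
  have := isDomain hf
  rw [injective_iff_map_eq_zero]
  intro a ha
  by_contra ha0
  have h1 := AdjoinRoot.norm_ne_zero hf.monic ha0
  obtain ⟨b, hb⟩ := AdjoinRoot.dvd_of_norm hf.monic a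
  have h2 := congrArg (relFrobenius hfr) hb
  rw [map_mul, ha, zero_mul, relFrobenius_of] at h2
  have hinj := AdjoinRoot.of.injective_of_degree_ne_zero (f := f) (by
    rw [degree_eq_natDegree hf.monic.ne_zero]; exact_mod_cast hd)
  rw [map_eq_zero_iff _ hinj] at h2
  exact h1 ((expand_eq_zero (Fact.out : p.Prime).pos).1 h2)

theorem hamiltonian_relFrobenius (hf : IsPlaneCurve f) (a : AdjoinRoot f) :
    hamiltonian hf (relFrobenius hfr a) = 0 := by
  have := isDomain hf
  have : CharP (AdjoinRoot f) p :=
    charP_of_injective_algebraMap (algebraMap k (AdjoinRoot f)).injective p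
  have hp : ∀ b : AdjoinRoot f, hamiltonian hf (b ^ p) = 0 := fun b => by
    rw [Derivation.leibniz_pow]
    simp
  obtain ⟨G, rfl⟩ := AdjoinRoot.mk_surjective a
  induction G using Polynomial.induction_on' with
  | add p q hp hq => simp only [map_add, hp, hq, add_zero]
  | monomial n P =>
    rw [← C_mul_X_pow_eq_monomial, map_mul, map_mul, map_pow, map_pow, AdjoinRoot.mk_X,
      AdjoinRoot.mk_C, relFrobenius_root, ← pow_mul, mul_comm p, pow_mul, relFrobenius,
      AdjoinRoot.lift_of, Derivation.leibniz, hp, RingHom.coe_coe, Derivation.map_aeval, hp]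
    simp

theorem eq_zero_of_eval₂_relFrobenius (hf : IsPlaneCurve f) (hd : (f.natDegree : k) ≠ 0)
    {q : (AdjoinRoot f)[X]} (hq : q.natDegree < p)
    (h : q.eval₂ (relFrobenius hfr) (AdjoinRoot.of f X) = 0) : q = 0 := by
  have := isDomain hf
  have : CharP (AdjoinRoot f) p :=
    charP_of_injective_algebraMap (algebraMap k (AdjoinRoot f)).injective p
  have hd0 : f.natDegree ≠ 0 := by rintro h; simp [h] at hd
  have hderiv : ∀ q : (AdjoinRoot f)[X],
      hamiltonian hf (q.eval₂ (relFrobenius hfr) (AdjoinRoot.of f X)) =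
        AdjoinRoot.mk f (derivative f) *
          (derivative q).eval₂ (relFrobenius hfr) (AdjoinRoot.of f X) := fun q => by
    induction q using Polynomial.induction_on' with
    | add q r hq hr => simp only [eval₂_add, map_add, hq, hr, mul_add]
    | monomial n a =>
      rw [eval₂_monomial, Derivation.leibniz, hamiltonian_relFrobenius, Derivation.leibniz_pow,
        hamiltonian_of_X, derivative_monomial, eval₂_monomial]
      simp only [smul_eq_mul, nsmul_eq_mul, mul_zero, add_zero, map_mul, map_natCast]
      ring
  induction hn : q.natDegree using Nat.strong_induction_on generalizing q with
  | _ n ih =>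
  have h1 := hderiv q
  rw [h, map_zero] at h1
  have h2 := (mul_eq_zero.1 h1.symm).resolve_left (mk_derivative_ne_zero hf hd)
  have hconst : q.natDegree = 0 := by
    by_contra hq0
    have hlt := natDegree_derivative_lt hq0
    have h3 := ih _ (hn ▸ hlt) (hlt.trans hq) h2 rfl
    have h4 := congrArg (coeff · (q.natDegree - 1)) h3
    simp only [coeff_derivative, coeff_zero] at h4
    rw [show q.natDegree - 1 + 1 = q.natDegree by omega] at h4
    rcases mul_eq_zero.1 h4 with h5 | h5
    · exact hq0 (by rw [leadingCoeff_eq_zero.1 h5, natDegree_zero])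
    · have h6 : ((q.natDegree : ℕ) : AdjoinRoot f) = 0 := by
        rw [← h5, show ((q.natDegree - 1 : ℕ) : AdjoinRoot f) + 1 =
          ((q.natDegree - 1 + 1 : ℕ) : AdjoinRoot f) by push_cast; ring,
          show q.natDegree - 1 + 1 = q.natDegree by omega]
      rw [CharP.cast_eq_zero_iff _ p] at h6
      exact absurd (Nat.le_of_dvd (by omega) h6) (by omega)
  rw [eq_C_of_natDegree_eq_zero hconst, eval₂_C] at h
  rw [eq_C_of_natDegree_eq_zero hconst,
    (injective_iff_map_eq_zero _).1 (relFrobenius_injective hfr hf hd0) _ h, C_0]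

end Frobenius

end PlaneCurve

namespace PlaneCurve

variable {k : Type*} [Field k] {f : k[X][X]}

section Square

variable (f)

/-- The inclusion of the coefficient ring `A` into the coordinate ring of the curve over `A`. -/
noncomputable def leftInclusion : AdjoinRoot f →+* AdjoinRoot (selfBaseChange f) :=
  (AdjoinRoot.of (selfBaseChange f)).comp C

/-- The inclusion `x ↦ X`, `y ↦ Y` of `A` into the coordinate ring of the curve over `A`. -/
noncomputable def rightInclusion : AdjoinRoot f →+* AdjoinRoot (selfBaseChange f) :=
  AdjoinRoot.lift ((AdjoinRoot.of (selfBaseChange f)).comp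
      (mapRingHom (algebraMap k (AdjoinRoot f)))) (AdjoinRoot.root (selfBaseChange f)) (by
    rw [← eval₂_map]
    exact AdjoinRoot.eval₂_root _)

theorem rightInclusion_of (P : k[X]) : rightInclusion f (AdjoinRoot.of f P) =
    AdjoinRoot.of (selfBaseChange f) (P.map (algebraMap k (AdjoinRoot f))) := by
  rw [rightInclusion, AdjoinRoot.lift_of]
  rfl

theorem rightInclusion_root :
    rightInclusion f (AdjoinRoot.root f) = AdjoinRoot.root (selfBaseChange f) := by
  rw [rightInclusion, AdjoinRoot.lift_root]

theorem rightInclusion_algebraMap (c : k) :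
    rightInclusion f (algebraMap k (AdjoinRoot f) c) =
      leftInclusion f (algebraMap k (AdjoinRoot f) c) := by
  have h : algebraMap k (AdjoinRoot f) c = AdjoinRoot.of f (C c) := rfl
  rw [h, rightInclusion_of, map_C]
  rfl

/-- The unique extension of a pair of points of the curve to the coordinate ring over `A`. -/
theorem eval₂_selfBaseChange {S : Type*} [CommRing S] (α β : AdjoinRoot f →+* S)
    (h : ∀ c : k, α (algebraMap k (AdjoinRoot f) c) = β (algebraMap k (AdjoinRoot f) c)) :
    (selfBaseChange f).eval₂ (eval₂RingHom α (β (AdjoinRoot.of f X)))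
      (β (AdjoinRoot.root f)) = 0 := by
  have key : (eval₂RingHom α (β (AdjoinRoot.of f X))).comp
      (mapRingHom (algebraMap k (AdjoinRoot f))) = β.comp (AdjoinRoot.of f) := by
    refine Polynomial.ringHom_ext' (RingHom.ext fun c => ?_) ?_
    · simp only [RingHom.comp_apply, coe_mapRingHom, map_C, coe_eval₂RingHom, eval₂_C, h]
      rfl
    · simp
  rw [selfBaseChange, eval₂_map, key, ← hom_eval₂, AdjoinRoot.eval₂_root, map_zero]

/-- The exchange of the two factors of the square of the curve. -/
noncomputable def exchange : AdjoinRoot (selfBaseChange f) →+* AdjoinRoot (selfBaseChange f) :=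
  AdjoinRoot.lift _ _ (eval₂_selfBaseChange f (rightInclusion f) (leftInclusion f)
    (rightInclusion_algebraMap f))

theorem exchange_leftInclusion (a : AdjoinRoot f) :
    exchange f (leftInclusion f a) = rightInclusion f a := by
  rw [leftInclusion, RingHom.comp_apply, exchange, AdjoinRoot.lift_of, coe_eval₂RingHom, eval₂_C]

theorem exchange_of_X :
    exchange f (AdjoinRoot.of (selfBaseChange f) X) = leftInclusion f (AdjoinRoot.of f X) := by
  rw [exchange, AdjoinRoot.lift_of, coe_eval₂RingHom, eval₂_X]

theorem exchange_root :
    exchange f (AdjoinRoot.root (selfBaseChange f)) = leftInclusion f (AdjoinRoot.root f) := by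
  rw [exchange, AdjoinRoot.lift_root]

theorem exchange_rightInclusion (a : AdjoinRoot f) :
    exchange f (rightInclusion f a) = leftInclusion f a := by
  have h : (exchange f).comp (rightInclusion f) = leftInclusion f := by
    refine AdjoinRoot.ringHom_ext (Polynomial.ringHom_ext' (RingHom.ext fun c => ?_) ?_) ?_
    · have h1 : AdjoinRoot.of f (C c) = algebraMap k (AdjoinRoot f) c := rfl
      simp only [RingHom.comp_apply, h1]
      rw [rightInclusion_algebraMap, exchange_leftInclusion, rightInclusion_algebraMap]
    · simp only [RingHom.comp_apply]
      rw [rightInclusion_of, map_X, exchange_of_X]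
    · rw [RingHom.comp_apply, rightInclusion_root, exchange_root]
  exact RingHom.congr_fun h a

theorem exchange_exchange (b : AdjoinRoot (selfBaseChange f)) : exchange f (exchange f b) = b := by
  have h : (exchange f).comp (exchange f) = RingHom.id _ := by
    refine AdjoinRoot.ringHom_ext (Polynomial.ringHom_ext' (RingHom.ext fun a => ?_) ?_) ?_
    · change exchange f (exchange f (leftInclusion f a)) = leftInclusion f a
      rw [exchange_leftInclusion, exchange_rightInclusion]
    · simp only [RingHom.comp_apply, RingHom.id_apply]
      rw [exchange_of_X, exchange_leftInclusion, rightInclusion_of, map_X]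
    · rw [RingHom.comp_apply, exchange_root, exchange_leftInclusion, rightInclusion_root,
        RingHom.id_apply]
  exact RingHom.congr_fun h b

theorem exists_mk_eq_exchange {n : ℤ} {Θ : (AdjoinRoot f)[X][X]}
    (hΘ : Θ ∈ (fil f).poly.poly.carrier n) :
    ∃ H ∈ (DegFil.triv k (AdjoinRoot f)).poly.poly.carrier n,
      AdjoinRoot.mk (selfBaseChange f) H = exchange f (AdjoinRoot.mk (selfBaseChange f) Θ) := by
  set W := ((DegFil.triv k (AdjoinRoot f)).poly.poly).map
    ((AdjoinRoot.mkₐ (selfBaseChange f)).restrictScalars k) with hW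
  have hmk : ∀ {n : ℤ} {H}, H ∈ (DegFil.triv k (AdjoinRoot f)).poly.poly.carrier n →
      AdjoinRoot.mk (selfBaseChange f) H ∈ W.carrier n := fun h => ⟨_, h, rfl⟩
  suffices h : exchange f (AdjoinRoot.mk (selfBaseChange f) Θ) ∈ W.carrier n by
    obtain ⟨H, hH, h⟩ := h
    exact ⟨H, hH, h⟩
  have hleft : ∀ a, leftInclusion f a ∈ W.carrier 0 := fun a =>
    hmk (H := C (C a)) (DegFil.C_mem_poly (DegFil.C_mem_poly
      (DegFil.mem_triv_of_nonneg le_rfl a)))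
  have hright : ∀ {n : ℤ} {a}, a ∈ (fil f).carrier n → rightInclusion f a ∈ W.carrier n := by
    rintro n _ ⟨G, hG, rfl⟩
    have e : rightInclusion f (AdjoinRoot.mk f G) = AdjoinRoot.mk (selfBaseChange f)
        (G.map (mapRingHom (algebraMap k (AdjoinRoot f)))) := by
      rw [rightInclusion, AdjoinRoot.lift_mk, ← eval₂_map, ← AdjoinRoot.aeval_eq, aeval_def,
        AdjoinRoot.algebraMap_eq]
    change rightInclusion f (AdjoinRoot.mk f G) ∈ _
    rw [e]
    refine hmk fun i j => ?_
    rw [coeff_map, coe_mapRingHom, coeff_map]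
    rcases lt_or_ge (n - i - j) 0 with h | h
    · rw [DegFil.eq_zero_of_mem_triv h (hG i j), map_zero]
      exact zero_mem _
    · exact DegFil.mem_triv_of_nonneg h _
  have hadd : ∀ {m n : ℤ} {a b}, a ∈ W.carrier m → b ∈ W.carrier 0 → m ≤ n →
      a * b ∈ W.carrier n := fun ha hb h =>
    W.mono (by omega) (W.mul_mem ha hb)
  rw [exchange, AdjoinRoot.lift_mk, eval₂_eq_sum_range]
  refine sum_mem fun e _ => hadd (m := n - e) ?_ ?_ (by omega)
  · rw [coe_eval₂RingHom, eval₂_eq_sum_range]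
    refine sum_mem fun c _ => hadd (hright (hΘ e c)) ?_ (by omega)
    rw [← map_pow]
    exact hleft _
  · rw [← map_pow]
    exact hleft _

end Square

section Frobenius

variable {p : ℕ} [Fact p.Prime] [CharP k p]

section

variable (hfr : f.map (mapRingHom (frobenius k p)) = f)

theorem relFrobenius_algebraMap (c : k) :
    relFrobenius hfr (algebraMap k (AdjoinRoot f) c) = algebraMap k (AdjoinRoot f) c := by
  have h : algebraMap k (AdjoinRoot f) c = AdjoinRoot.of f (C c) := rfl
  rw [h, relFrobenius_of, expand_C]

/-- The pullback along the graph of the relative Frobenius. -/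
noncomputable def graphPullback : AdjoinRoot (selfBaseChange f) →+* AdjoinRoot f :=
  AdjoinRoot.lift _ _ (eval₂_selfBaseChange f (relFrobenius hfr) (RingHom.id _)
    (relFrobenius_algebraMap hfr))

theorem graphPullback_rightInclusion (a : AdjoinRoot f) :
    graphPullback hfr (rightInclusion f a) = a := by
  have h : (graphPullback hfr).comp (rightInclusion f) = RingHom.id _ := by
    refine AdjoinRoot.ringHom_ext (Polynomial.ringHom_ext' (RingHom.ext fun c => ?_) ?_) ?_
    · simp only [RingHom.comp_apply, rightInclusion_of, map_C, RingHom.id_apply]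
      rw [graphPullback, AdjoinRoot.lift_of, coe_eval₂RingHom, eval₂_C, relFrobenius_algebraMap]
      rfl
    · simp only [RingHom.comp_apply, rightInclusion_of, map_X, RingHom.id_apply]
      rw [graphPullback, AdjoinRoot.lift_of, coe_eval₂RingHom, eval₂_X, RingHom.id_apply]
    · rw [RingHom.comp_apply, rightInclusion_root, graphPullback, AdjoinRoot.lift_root]
  exact RingHom.congr_fun h a

theorem graphPullback_of (q : (AdjoinRoot f)[X]) :
    graphPullback hfr (AdjoinRoot.of _ q) = q.eval₂ (relFrobenius hfr) (AdjoinRoot.of f X) := by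
  rw [graphPullback, AdjoinRoot.lift_of]
  rfl

theorem graphPullback_leftInclusion (a : AdjoinRoot f) :
    graphPullback hfr (leftInclusion f a) = relFrobenius hfr a := by
  rw [leftInclusion, RingHom.comp_apply, graphPullback_of, eval₂_C]

theorem graphPullback_exchange_mk (Θ : (AdjoinRoot f)[X][X]) :
    graphPullback hfr (exchange f (AdjoinRoot.mk _ Θ)) =
      evalEval (AdjoinRoot.of f X ^ p) (AdjoinRoot.root f ^ p) Θ := by
  have h : ((graphPullback hfr).comp (exchange f)).comp (AdjoinRoot.mk _) =
      evalEvalRingHom (AdjoinRoot.of f X ^ p) (AdjoinRoot.root f ^ p) := by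
    refine Polynomial.ringHom_ext' (Polynomial.ringHom_ext' (RingHom.ext fun c => ?_) ?_) ?_
    · simp only [RingHom.comp_apply, AdjoinRoot.mk_C]
      change graphPullback hfr (exchange f (leftInclusion f c)) = _
      rw [exchange_leftInclusion, graphPullback_rightInclusion]
      simp
    · simp only [RingHom.comp_apply, AdjoinRoot.mk_C]
      rw [exchange_of_X, graphPullback_leftInclusion, relFrobenius_of, expand_X]
      simp
    · simp only [RingHom.comp_apply, AdjoinRoot.mk_X]
      rw [exchange_root, graphPullback_leftInclusion, relFrobenius_root]
      simp
  exact RingHom.congr_fun h Θ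

end

theorem evalEval_pow_ne_zero [IsAlgClosed k]
    (hfr : f.map (mapRingHom (frobenius k p)) = f) (hf : IsPlaneCurve f)
    (hd : (f.natDegree : k) ≠ 0) {T : ℕ} (hT : f.natDegree * T < p)
    {Θ : (AdjoinRoot f)[X][X]} (hΘ : Θ ≠ 0)
    (hΘT : Θ ∈ (fil f).poly.poly.carrier T) (hΘd : ∀ e, f.natDegree ≤ e → Θ.coeff e = 0) :
    evalEval (AdjoinRoot.of f X ^ p) (AdjoinRoot.root f ^ p) Θ ≠ 0 := by
  have hd0 : f.natDegree ≠ 0 := by rintro h; simp [h] at hd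
  have := isDomain hf
  have hm := selfBaseChange_monic hf
  have := selfBaseChange_isDomain hf hd0
  have hne : AdjoinRoot.mk (selfBaseChange f) Θ ≠ 0 := by
    refine AdjoinRoot.mk_ne_zero_of_natDegree_lt hm hΘ ?_
    rw [natDegree_selfBaseChange hf]
    by_contra! h
    exact hΘ (leadingCoeff_eq_zero.1 (hΘd _ h))
  obtain ⟨H, hH, hHΘ⟩ := exists_mk_eq_exchange f hΘT
  have hH0 : AdjoinRoot.mk (selfBaseChange f) H ≠ 0 := fun h => hne <| by
    rw [← exchange_exchange f (AdjoinRoot.mk _ Θ), ← hHΘ, h, map_zero]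
  intro h0
  rw [← graphPullback_exchange_mk hfr, ← hHΘ] at h0
  refine AdjoinRoot.norm_ne_zero hm hH0 (eq_zero_of_eval₂_relFrobenius hfr hf hd ?_ ?_)
  · refine (AdjoinRoot.natDegree_norm_le (k := k) hm ?_ hH).trans_lt ?_
    · intro i j
      rw [natDegree_selfBaseChange hf, selfBaseChange, coeff_map, coe_mapRingHom, coeff_map]
      rcases lt_or_ge ((f.natDegree : ℤ) - i - j) 0 with h | h
      · rw [DegFil.eq_zero_of_mem_triv h (hf.mem i j), map_zero]
        exact zero_mem _
      · exact DegFil.mem_triv_of_nonneg h _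
    · rwa [natDegree_selfBaseChange hf]
  · rw [← graphPullback_of hfr]
    obtain ⟨b, hb⟩ := AdjoinRoot.dvd_of_norm hm (AdjoinRoot.mk (selfBaseChange f) H)
    rw [hb, map_mul, h0, zero_mul]

/-- Nonvanishing on the Frobenius graph. -/
theorem evalEval_sub_pow_ne_zero [IsAlgClosed k]
    (hfr : f.map (mapRingHom (frobenius k p)) = f) (hf : IsPlaneCurve f)
    (hd : (f.natDegree : k) ≠ 0)
    {T : ℕ} (hT : f.natDegree * T < p) {Θ : (AdjoinRoot f)[X][X]} (hΘ : Θ ≠ 0)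
    (hΘT : Θ ∈ (fil f).poly.poly.carrier T) (hΘd : ∀ e, f.natDegree ≤ e → Θ.coeff e = 0) :
    evalEval (AdjoinRoot.of f X ^ p - AdjoinRoot.of f X) (AdjoinRoot.root f ^ p) Θ ≠ 0 := by
  set x := AdjoinRoot.of f X with hx
  set τ : (AdjoinRoot f)[X] →+* (AdjoinRoot f)[X] := (taylorAlgHom (-x)).toRingHom with hτ
  have hτ_apply : ∀ q, τ q = taylor (-x) q := fun q => rfl
  have hinj : Function.Injective τ := taylor_injective (-x)
  have key : evalEval (x ^ p) (AdjoinRoot.root f ^ p) (Θ.map τ) =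
      evalEval (x ^ p - x) (AdjoinRoot.root f ^ p) Θ := by
    have h : (evalEvalRingHom (x ^ p) (AdjoinRoot.root f ^ p)).comp (mapRingHom τ) =
        evalEvalRingHom (x ^ p - x) (AdjoinRoot.root f ^ p) := by
      refine Polynomial.ringHom_ext' (Polynomial.ringHom_ext' (RingHom.ext fun c => ?_) ?_) ?_
      · simp [hτ_apply]
      · simp [hτ_apply, sub_eq_add_neg]
      · simp
    exact RingHom.congr_fun h Θ
  rw [← key]
  refine evalEval_pow_ne_zero hfr hf hd hT ?_ (fun i => ?_) (fun e he => ?_)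
  · rwa [Ne, Polynomial.map_eq_zero_iff hinj]
  · rw [coeff_map, hτ_apply]
    exact DegFil.taylor_mem (neg_mem of_X_mem_fil) (hΘT i)
  · rw [coeff_map, hΘd e he, map_zero]

end Frobenius

end PlaneCurve

section Multiplicity

variable {k : Type*} [Field k]

theorem rootMultiplicity_finsetProd {ι : Type*} (s : Finset ι) (q : ι → k[X])
    (h : ∀ i ∈ s, q i ≠ 0) (x : k) :
    (∏ i ∈ s, q i).rootMultiplicity x = ∑ i ∈ s, (q i).rootMultiplicity x := by
  classical
  induction s using Finset.induction_on with
  | empty =>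
    rw [Finset.prod_empty, Finset.sum_empty]
    exact rootMultiplicity_eq_zero (by simp)
  | insert i s hi ih =>
    have h1 : ∏ i ∈ s, q i ≠ 0 :=
      Finset.prod_ne_zero_iff.2 fun j hj => h j (Finset.mem_insert_of_mem hj)
    rw [Finset.prod_insert hi, Finset.sum_insert hi,
      rootMultiplicity_mul (mul_ne_zero (h i (Finset.mem_insert_self _ _)) h1),
      ih fun j hj => h j (Finset.mem_insert_of_mem hj)]

theorem rootMultiplicity_pow_eq {q : k[X]} (hq : q ≠ 0) (n : ℕ) (x : k) :
    (q ^ n).rootMultiplicity x = n * q.rootMultiplicity x := by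
  have := rootMultiplicity_finsetProd (Finset.range n) (fun _ => q) (fun _ _ => hq) x
  simpa using this

theorem rootMultiplicity_eq_ite {q : k[X]} {x : k} [Decidable (q.IsRoot x)] (hq : q ≠ 0)
    (h : q.IsRoot x → (derivative q).eval x ≠ 0) :
    q.rootMultiplicity x = if q.IsRoot x then 1 else 0 := by
  split_ifs with hr
  · have h1 := (rootMultiplicity_pos hq).2 hr
    have h2 : ¬ 1 < q.rootMultiplicity x := fun h2 =>
      h hr ((one_lt_rootMultiplicity_iff_isRoot hq).1 h2).2
    omega
  · exact rootMultiplicity_eq_zero hr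

theorem sum_rootMultiplicity_le {ι : Type*} (s : Finset ι) {e : ι → k}
    (he : Function.Injective e) (q : k[X]) :
    ∑ i ∈ s, q.rootMultiplicity (e i) ≤ q.natDegree := by
  classical
  have h1 : ∑ i ∈ s, q.rootMultiplicity (e i) =
      ∑ x ∈ s.map ⟨e, he⟩, q.roots.count x := by
    rw [Finset.sum_map]
    simp
  rw [h1]
  refine le_trans ?_ (card_roots' q)
  rw [← Multiset.toFinset_sum_count_eq]
  refine Finset.sum_le_sum_of_ne_zero fun x _ hx => ?_
  rwa [Multiset.mem_toFinset, ← Multiset.count_ne_zero]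

theorem prod_X_sub_C_algebraMap (p : ℕ) [Fact p.Prime] {R : Type*} [CommRing R]
    [Algebra (ZMod p) R] :
    ∏ c : ZMod p, (X - C (algebraMap (ZMod p) R c)) = X ^ p - X := by
  have h1 := FiniteField.roots_X_pow_card_sub_X (ZMod p)
  rw [ZMod.card] at h1
  have hp := (Fact.out : p.Prime).one_lt
  have hm : (X ^ p - X : (ZMod p)[X]).Monic := by
    refine monic_X_pow_sub ?_
    rw [degree_X]
    exact_mod_cast hp
  have h2 := prod_multiset_X_sub_C_of_monic_of_roots_card_eq hm (by
    rw [h1, FiniteField.X_pow_card_sub_X_natDegree_eq _ hp]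
    exact (Finset.card_univ).trans (ZMod.card p))
  rw [h1] at h2
  have h3 := congrArg (Polynomial.map (algebraMap (ZMod p) R)) h2
  change Polynomial.map _ (∏ c : ZMod p, (X - C c)) = _ at h3
  simpa [Polynomial.map_prod] using h3

theorem pow_dvd_pow_mul_of_mul_eq {A : Type*} [CommRing A] {t σ w s θ g : A} {M : ℕ}
    {γ : ℕ → A} (h : t * σ = w * s)
    (hθ : θ = ∑ j ∈ Finset.range M, t ^ (j + 1) * w ^ (M - 1 - j) * γ j + w ^ M * g) :
    w ^ M ∣ σ ^ M * θ := by
  rw [hθ, mul_add, Finset.mul_sum]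
  refine dvd_add (Finset.dvd_sum fun j hj => ?_) ⟨σ ^ M * g, by ring⟩
  rw [Finset.mem_range] at hj
  refine ⟨s ^ (j + 1) * σ ^ (M - 1 - j) * γ j, ?_⟩
  have h1 : σ ^ M = σ ^ (j + 1) * σ ^ (M - 1 - j) := by rw [← pow_add]; congr 1; omega
  have h2 : w ^ M = w ^ (j + 1) * w ^ (M - 1 - j) := by rw [← pow_add]; congr 1; omega
  rw [h1, h2]
  have h3 : t ^ (j + 1) * σ ^ (j + 1) = w ^ (j + 1) * s ^ (j + 1) := by
    rw [← mul_pow, h, mul_pow]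
  linear_combination (σ ^ (M - 1 - j) * w ^ (M - 1 - j) * γ j) * h3

theorem derivative_eval_C (G : k[X][X]) (c : k) :
    derivative (G.eval (C c)) = (innerDerivative G).eval (C c) := by
  induction G using Polynomial.induction_on' with
  | add p q hp hq => simp [hp, hq, innerDerivative_add]
  | monomial n a =>
    have h : innerDerivative (monomial n a) = monomial n (derivative a) := by
      ext1 i
      rw [coeff_innerDerivative, coeff_monomial, coeff_monomial]
      split_ifs
      · rfl
      · simp
    rw [h, eval_monomial, eval_monomial, ← C_pow, derivative_mul, derivative_C, mul_zero, add_zero]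

end Multiplicity

namespace PlaneCurve

variable {k : Type*} [Field k] {f : k[X][X]} {p : ℕ}

theorem norm_abscissa (hf : IsPlaneCurve f) :
    Algebra.norm k[X] (AdjoinRoot.of f X ^ p - AdjoinRoot.of f X) =
      (X ^ p - X) ^ f.natDegree := by
  rw [← map_pow, ← map_sub, AdjoinRoot.norm_of hf.monic]

/-- Substitution of the Frobenius graph: `W ↦ x ^ p - x`, `Y ↦ y ^ p`. -/
noncomputable def graphEval (f : k[X][X]) (p : ℕ) : (AdjoinRoot f)[X][X] →+* AdjoinRoot f :=
  evalEvalRingHom (AdjoinRoot.of f X ^ p - AdjoinRoot.of f X) (AdjoinRoot.root f ^ p)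

theorem graphEval_linearFactor :
    graphEval f p (linearFactor f) = AdjoinRoot.root f ^ p - AdjoinRoot.root f := by
  simp [graphEval, linearFactor]

theorem graphEval_C_X :
    graphEval f p (C X) = AdjoinRoot.of f X ^ p - AdjoinRoot.of f X := by
  simp [graphEval]

variable [Fact p.Prime]

theorem graphEval_shifted [CharP k p] (hfr : f.map (mapRingHom (frobenius k p)) = f) :
    graphEval f p (shifted f) = 0 := by
  have h := eval₂_frobenius_eq_zero hfr
  rw [graphEval, coe_evalEvalRingHom, ← eval₂_evalRingHom, shifted, eval₂_map]
  convert h using 2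
  refine RingHom.ext fun P => ?_
  simp only [RingHom.comp_apply, coe_evalRingHom, eval_shift, sub_add_cancel]
  rfl

theorem linear_mul_cofactor [CharP k p] (hfr : f.map (mapRingHom (frobenius k p)) = f) :
    graphEval f p (linearFactor f) * graphEval f p (cofactor f) =
      (AdjoinRoot.of f X ^ p - AdjoinRoot.of f X) *
        -((slope f).eval (AdjoinRoot.of f X ^ p - AdjoinRoot.of f X)) := by
  have h := congrArg (graphEval f p) (shifted_eq f)
  rw [graphEval_shifted hfr, map_add, map_mul, C_mul, map_mul, graphEval_C_X] at h
  have h2 : graphEval f p (C (slope f)) =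
      (slope f).eval (AdjoinRoot.of f X ^ p - AdjoinRoot.of f X) := by
    simp [graphEval]
  rw [h2] at h
  linear_combination -h

variable [Algebra (ZMod p) k]

open Classical in
/-- The number of rational points of the curve with a given abscissa. -/
noncomputable def fiberCard (p : ℕ) [Fact p.Prime] [Algebra (ZMod p) k] (f : k[X][X])
    (a : ZMod p) : ℕ :=
  (Finset.univ.filter fun b : ZMod p =>
    evalEval (algebraMap (ZMod p) k a) (algebraMap (ZMod p) k b) f = 0).card

theorem eval_norm_eq_zero (hf : IsPlaneCurve f) {x y : k} (h : evalEval x y f = 0)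
    {G : k[X][X]} (hG : evalEval x y G = 0) :
    (Algebra.norm k[X] (AdjoinRoot.mk f G)).eval x = 0 := by
  have hl : ∀ H, AdjoinRoot.lift (evalRingHom x) y (eval₂_evalRingHom x ▸ h) (AdjoinRoot.mk f H) =
      evalEval x y H := fun H => by rw [AdjoinRoot.lift_mk, eval₂_evalRingHom]
  obtain ⟨b, hb⟩ := AdjoinRoot.dvd_of_norm hf.monic (AdjoinRoot.mk f G)
  have h1 := congrArg (AdjoinRoot.lift (evalRingHom x) y (eval₂_evalRingHom x ▸ h)) hb
  rwa [map_mul, hl, hG, zero_mul, AdjoinRoot.lift_of] at h1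

theorem of_sub_root_ne_zero (hf : IsPlaneCurve f) (hd : 2 ≤ f.natDegree) (P : k[X]) :
    AdjoinRoot.of f P - AdjoinRoot.root f ≠ 0 := by
  rw [← neg_ne_zero, neg_sub, ← AdjoinRoot.mk_X, ← AdjoinRoot.mk_C, ← map_sub]
  refine AdjoinRoot.mk_ne_zero_of_natDegree_lt hf.monic (X_sub_C_ne_zero P) ?_
  rw [natDegree_X_sub_C]
  omega

theorem norm_neg_one_mul (hf : IsPlaneCurve f) (n : ℕ) (x : AdjoinRoot f) (a : k) :
    (Algebra.norm k[X] ((-1) ^ n * x)).rootMultiplicity a =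
      (Algebra.norm k[X] x).rootMultiplicity a := by
  have h : ((-1 : AdjoinRoot f) ^ n) = AdjoinRoot.of f ((-1) ^ n) := by simp
  rw [map_mul, h, AdjoinRoot.norm_of hf.monic, ← pow_mul]
  rcases neg_one_pow_eq_or k[X] (n * f.natDegree) with h | h <;> rw [h]
  · rw [one_mul]
  · classical
    rw [neg_one_mul, ← count_roots, roots_neg, count_roots]

theorem root_pow_sub_root :
    AdjoinRoot.root f ^ p - AdjoinRoot.root f = (-1) ^ p *
      ∏ c : ZMod p, (AdjoinRoot.of f (C (algebraMap (ZMod p) k c)) - AdjoinRoot.root f) := by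
  have h1 := congrArg (aeval (R := k) (AdjoinRoot.root f))
    (prod_X_sub_C_algebraMap p (R := k))
  rw [map_prod] at h1
  simp only [map_sub, map_pow, aeval_X, aeval_C] at h1
  have h2 : ∏ _c : ZMod p, (-1 : AdjoinRoot f) = (-1) ^ p := by
    rw [Finset.prod_const, Finset.card_univ, ZMod.card]
  rw [← h1, ← h2, ← Finset.prod_mul_distrib]
  refine Finset.prod_congr rfl fun c _ => ?_
  rw [neg_one_mul, neg_sub]
  rfl

theorem rootMultiplicity_norm_linear (hf : IsPlaneCurve f) (hd : 2 ≤ f.natDegree) {a : ZMod p}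
    (ha : (Algebra.norm k[X] (AdjoinRoot.mk f (innerDerivative f))).eval
      (algebraMap (ZMod p) k a) ≠ 0) :
    (Algebra.norm k[X] (AdjoinRoot.root f ^ p - AdjoinRoot.root f)).rootMultiplicity
      (algebraMap (ZMod p) k a) = fiberCard p f a := by
  classical
  have := isDomain hf
  rw [root_pow_sub_root, norm_neg_one_mul hf, map_prod]
  have hne : ∀ c : k, f.eval (C c) ≠ 0 := fun c => by
    rw [← AdjoinRoot.norm_of_sub_root hf.monic]
    exact AdjoinRoot.norm_ne_zero hf.monic (of_sub_root_ne_zero hf hd _)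
  simp only [AdjoinRoot.norm_of_sub_root hf.monic]
  rw [rootMultiplicity_finsetProd _ _ fun c _ => hne _, fiberCard, Finset.card_filter]
  refine Finset.sum_congr rfl fun c _ => ?_
  rw [rootMultiplicity_eq_ite (hne _)]
  · rfl
  · intro h h0
    rw [derivative_eval_C] at h0
    exact ha (eval_norm_eq_zero hf h h0)

theorem rootMultiplicity_X_pow_sub_X (a : ZMod p) :
    (X ^ p - X : k[X]).rootMultiplicity (algebraMap (ZMod p) k a) = 1 := by
  classical
  have hp := (Fact.out : p.Prime).one_lt
  have : CharP k p := charP_of_injective_algebraMap (algebraMap (ZMod p) k).injective p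
  rw [rootMultiplicity_eq_ite (FiniteField.X_pow_card_sub_X_ne_zero _ hp), if_pos]
  · rw [IsRoot, eval_sub, eval_pow, eval_X, ← map_pow, ZMod.pow_card, sub_self]
  · intro _
    rw [derivative_sub, derivative_X_pow, derivative_X, CharP.cast_eq_zero]
    simp

theorem eval_norm_slope (hf : IsPlaneCurve f) (a : ZMod p) :
    (Algebra.norm k[X] (-((slope f).eval (AdjoinRoot.of f X ^ p - AdjoinRoot.of f X)))).eval
        (algebraMap (ZMod p) k a) =
      (Algebra.norm k[X] (-(AdjoinRoot.mk f (innerDerivative f)))).eval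
        (algebraMap (ZMod p) k a) := by
  rw [← map_pow, ← map_sub]
  set s : k[X] := X ^ p - X with hs
  have hs0 : evalRingHom (algebraMap (ZMod p) k a) s = 0 := by
    rw [coe_evalRingHom, hs, eval_sub, eval_pow, eval_X, ← map_pow, ZMod.pow_card, sub_self]
  have h := X_mul_divX_add (slope f)
  rw [← h]
  have h1 := AdjoinRoot.map_norm_add_of_mul hf.monic (evalRingHom (algebraMap (ZMod p) k a)) hs0
    (-(AdjoinRoot.mk f (innerDerivative f))) (-((slope f).divX.eval (AdjoinRoot.of f s)))
  rw [coe_evalRingHom] at h1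
  rw [← h1, slope_coeff_zero]
  congr 2
  simp only [eval_add, eval_mul, eval_X, eval_C]
  ring

theorem rootMultiplicity_norm_cofactor [CharP k p] (hf : IsPlaneCurve f)
    (hfr : f.map (mapRingHom (frobenius k p)) = f) (hd : 2 ≤ f.natDegree)
    {a : ZMod p} (ha : (Algebra.norm k[X] (AdjoinRoot.mk f (innerDerivative f))).eval
      (algebraMap (ZMod p) k a) ≠ 0) :
    graphEval f p (cofactor f) ≠ 0 ∧
      (Algebra.norm k[X] (graphEval f p (cofactor f))).rootMultiplicity
        (algebraMap (ZMod p) k a) + fiberCard p f a = f.natDegree := by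
  have := isDomain hf
  have h1 := congrArg (fun x => (Algebra.norm k[X] x)) (linear_mul_cofactor (p := p) hfr)
  simp only [map_mul] at h1
  rw [norm_abscissa hf] at h1
  have hp := (Fact.out : p.Prime).one_lt
  have hX := FiniteField.X_pow_card_sub_X_ne_zero k hp
  have hslope : ¬ (Algebra.norm k[X]
      (-((slope f).eval (AdjoinRoot.of f X ^ p - AdjoinRoot.of f X)))).IsRoot
        (algebraMap (ZMod p) k a) := by
    rw [IsRoot, eval_norm_slope hf, ← neg_one_mul, map_mul, eval_mul]
    refine mul_ne_zero ?_ ha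
    have e : (-1 : AdjoinRoot f) = AdjoinRoot.of f (-1) := by simp
    rw [e, AdjoinRoot.norm_of hf.monic]
    simp
  have hs0 : Algebra.norm k[X]
      (-((slope f).eval (AdjoinRoot.of f X ^ p - AdjoinRoot.of f X))) ≠ 0 := fun h =>
    hslope (by rw [h]; simp)
  have hr0 := mul_ne_zero (pow_ne_zero f.natDegree hX) hs0
  have h2 := congrArg (rootMultiplicity (algebraMap (ZMod p) k a)) h1
  rw [rootMultiplicity_mul hr0, rootMultiplicity_mul (h1 ▸ hr0),
    rootMultiplicity_pow_eq hX, rootMultiplicity_X_pow_sub_X, rootMultiplicity_eq_zero hslope,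
    graphEval_linearFactor, rootMultiplicity_norm_linear hf hd ha] at h2
  refine ⟨fun h => ?_, by omega⟩
  rw [h] at h1
  refine hr0 (h1.symm.trans ?_)
  have := hf.monic.free_adjoinRoot
  have := hf.monic.finite_adjoinRoot
  rw [Algebra.norm_eq_zero_iff.2 rfl, mul_zero]

end PlaneCurve

namespace PlaneCurve

variable {k : Type*} [Field k] {f : k[X][X]} {p : ℕ} [Fact p.Prime]

theorem graphEval_mem_fil {T : ℤ} {D : ℕ} {Θ : (AdjoinRoot f)[X][X]}
    (hΘ : Θ ∈ (fil f).poly.poly.carrier T)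
    (h0 : ∀ e c, f.natDegree ≤ e ∨ D ≤ c → (Θ.coeff e).coeff c = 0) :
    graphEval f p Θ ∈ (fil f).carrier (T + p * (D + f.natDegree : ℕ)) := by
  have hp := (Fact.out : p.Prime).one_lt
  have hy : AdjoinRoot.root f ^ p ∈ (fil f).carrier p := by
    simpa using DegFil.pow_mem _ (root_mem_fil (f := f)) p
  have hx : AdjoinRoot.of f X ^ p - AdjoinRoot.of f X ∈ (fil f).carrier p := by
    refine sub_mem ?_ (DegFil.mono _ ?_ of_X_mem_fil)
    · simpa using DegFil.pow_mem _ (of_X_mem_fil (f := f)) p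
    · exact_mod_cast hp.le
  set w := AdjoinRoot.of f X ^ p - AdjoinRoot.of f X with hw
  have hsum : graphEval f p Θ = ∑ e ∈ Finset.range (Θ.natDegree + 1),
      (∑ c ∈ Finset.range ((Θ.coeff e).natDegree + 1), (Θ.coeff e).coeff c * w ^ c) *
        (AdjoinRoot.root f ^ p) ^ e := by
    rw [graphEval, coe_evalEvalRingHom, ← eval₂_evalRingHom, eval₂_eq_sum_range]
    refine Finset.sum_congr rfl fun e _ => ?_
    rw [coe_evalRingHom, eval_eq_sum_range]
  rw [hsum]
  refine sum_mem fun e _ => ?_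
  rw [Finset.sum_mul]
  refine sum_mem fun c _ => ?_
  by_cases h : f.natDegree ≤ e ∨ D ≤ c
  · rw [h0 e c h, zero_mul, zero_mul]
    exact zero_mem _
  · refine DegFil.mono _ ?_ (DegFil.mul_mem _ (DegFil.mul_mem _ (hΘ e c)
      (DegFil.pow_mem _ hx c)) (DegFil.pow_mem _ hy e))
    push Not at h
    have h1 : (p : ℤ) * (c + e) ≤ p * (D + f.natDegree : ℕ) :=
      mul_le_mul_of_nonneg_left (by omega) (by positivity)
    have h2 : (c : ℤ) * p + e * p = p * (c + e) := by ring
    omega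

theorem exists_dvd_graph [IsAlgClosed k] [CharP k p] (hf : IsPlaneCurve f)
    (hfr : f.map (mapRingHom (frobenius k p)) = f) (hd : (f.natDegree : k) ≠ 0)
    {τ σ : (AdjoinRoot f)[X][X]} {s : AdjoinRoot f}
    (hτσ : graphEval f p τ * graphEval f p σ = (AdjoinRoot.of f X ^ p - AdjoinRoot.of f X) * s)
    {n δ : ℕ} (hδ : 1 ≤ δ) (hτ : τ ∈ (fil f).poly.poly.carrier δ)
    (H : ∀ (M : ℕ) (g : (AdjoinRoot f)[X]), g.degree < n →
      reduceInner _ (shifted f) ∣ reduceInner _ τ ^ M * g → g = 0)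
    {M T n₀ D L : ℕ} (hT : f.natDegree * T < p) (hn₀ : n₀ + f.natDegree + δ * M + n ≤ T)
    (hL : D + L = M)
    (hdim : f.natDegree * L * ((T + 1) * f.natDegree) < M * n * (n₀ * f.natDegree)) :
    ∃ θ ∈ (fil f).carrier ((T + p * (D + f.natDegree) : ℕ) : ℤ), θ ≠ 0 ∧
      (AdjoinRoot.of f X ^ p - AdjoinRoot.of f X) ^ M ∣ graphEval f p σ ^ M * θ := by
  have := isDomain hf
  have := finiteDimensional_fil hf T
  have hV : monomialSpan hf n₀ ≤ (fil f).carrier ((T : ℤ) - δ * M - n) :=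
    (monomialSpan_le hf n₀).trans (DegFil.mono _ (by zify at hn₀; linarith))
  have hmem := shifted_mem hf
  rw [← natDegree_shifted hf] at hmem
  have hdim' : (shifted f).natDegree * L * Module.finrank k ((fil f).carrier T) <
      M * n * Module.finrank k (monomialSpan hf n₀) := by
    rw [natDegree_shifted hf, finrank_monomialSpan]
    exact (Nat.mul_le_mul_left _ (finrank_fil_le hf T)).trans_lt hdim
  obtain ⟨Θ, G, K, γ, hΘ, hΘT, hΘ0, hΘeq⟩ :=
    exists_auxiliary (shifted_monic hf) hmem hδ hτ H hV hL hdim'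
  rw [natDegree_shifted hf] at hΘ0
  refine ⟨graphEval f p Θ, ?_, ?_, ?_⟩
  · exact_mod_cast graphEval_mem_fil hΘT hΘ0
  · refine evalEval_sub_pow_ne_zero hfr hf hd hT hΘ hΘT fun e he => ?_
    ext1 c
    rw [hΘ0 e c (Or.inl he), coeff_zero]
  · refine pow_dvd_pow_mul_of_mul_eq (γ := fun j => graphEval f p (γ j))
      (g := graphEval f p G) hτσ ?_
    have h := congrArg (graphEval f p) hΘeq
    simp only [map_add, map_sum, map_mul, map_pow, graphEval_C_X, graphEval_shifted hfr,
      zero_mul, add_zero] at h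
    exact h

variable [Algebra (ZMod p) k]

theorem mul_le_of_dvd_graph (hf : IsPlaneCurve f) {σ θ : AdjoinRoot f} (hσ : σ ≠ 0) (hθ : θ ≠ 0)
    {M : ℕ} (h : (AdjoinRoot.of f X ^ p - AdjoinRoot.of f X) ^ M ∣ σ ^ M * θ) (a : ZMod p) :
    f.natDegree * M ≤
      M * (Algebra.norm k[X] σ).rootMultiplicity (algebraMap (ZMod p) k a) +
        (Algebra.norm k[X] θ).rootMultiplicity (algebraMap (ZMod p) k a) := by
  have := isDomain hf
  have hX := FiniteField.X_pow_card_sub_X_ne_zero k (Fact.out : p.Prime).one_lt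
  have hσ' := AdjoinRoot.norm_ne_zero hf.monic hσ
  have hθ' := AdjoinRoot.norm_ne_zero hf.monic hθ
  have h1 := map_dvd (Algebra.norm k[X]) h
  rw [map_pow, norm_abscissa hf, map_mul, map_pow, ← pow_mul] at h1
  have hne := mul_ne_zero (pow_ne_zero M hσ') hθ'
  have h2 := rootMultiplicity_le_rootMultiplicity_of_dvd hne h1 (algebraMap (ZMod p) k a)
  rwa [rootMultiplicity_pow_eq hX, rootMultiplicity_X_pow_sub_X, mul_one,
    rootMultiplicity_mul hne, rootMultiplicity_pow_eq hσ'] at h2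

theorem natDegree_norm_le_of_mem_fil (hf : IsPlaneCurve f) {m : ℕ} {θ : AdjoinRoot f}
    (h : θ ∈ (fil f).carrier m) : (Algebra.norm k[X] θ).natDegree ≤ f.natDegree * m := by
  obtain ⟨G, hG, rfl⟩ := h
  exact AdjoinRoot.natDegree_norm_le (k := k) hf.monic hf.mem hG

open Classical in
/-- The abscissas over which the curve has no point with `∂f/∂x = 0`. -/
noncomputable def goodAbscissas (p : ℕ) [Fact p.Prime] [Algebra (ZMod p) k] (f : k[X][X]) :
    Finset (ZMod p) :=
  Finset.univ.filter fun a => (Algebra.norm k[X] (AdjoinRoot.mk f (innerDerivative f))).eval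
      (algebraMap (ZMod p) k a) ≠ 0

theorem card_le_card_goodAbscissas_add [IsAlgClosed k] (hf : IsPlaneCurve f)
    (hd : 2 ≤ f.natDegree) (hchar : ∀ j, 0 < j → j ≤ f.natDegree → (j : k) ≠ 0) :
    p ≤ (goodAbscissas p f).card + f.natDegree ^ 2 := by
  classical
  have := isDomain hf
  have h0 := AdjoinRoot.norm_ne_zero hf.monic (mk_innerDerivative_ne_zero hf hd hchar)
  have h1 := Finset.card_filter_add_card_filter_not (s := (Finset.univ : Finset (ZMod p)))
    fun a => (Algebra.norm k[X] (AdjoinRoot.mk f (innerDerivative f))).eval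
      (algebraMap (ZMod p) k a) ≠ 0
  rw [Finset.card_univ, ZMod.card] at h1
  have hmem : AdjoinRoot.mk f (innerDerivative f) ∈ (fil f).carrier (f.natDegree : ℕ) :=
    DegFil.mono _ (by omega) (mk_mem_fil (DegFil.innerDerivative_mem hf.mem))
  have h2 := natDegree_norm_le_of_mem_fil hf hmem
  have h3 := sum_rootMultiplicity_le (Finset.univ.filter fun a : ZMod p =>
    ¬ (Algebra.norm k[X] (AdjoinRoot.mk f (innerDerivative f))).eval
      (algebraMap (ZMod p) k a) ≠ 0) (algebraMap (ZMod p) k).injective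
      (Algebra.norm k[X] (AdjoinRoot.mk f (innerDerivative f)))
  have h4 := Finset.card_nsmul_le_sum (Finset.univ.filter fun a : ZMod p =>
    ¬ (Algebra.norm k[X] (AdjoinRoot.mk f (innerDerivative f))).eval
      (algebraMap (ZMod p) k a) ≠ 0) (fun a => (Algebra.norm k[X]
        (AdjoinRoot.mk f (innerDerivative f))).rootMultiplicity (algebraMap (ZMod p) k a)) 1
      (fun a ha => by
        rw [Finset.mem_filter, not_not] at ha
        exact (rootMultiplicity_pos h0).2 ha.2)
  rw [smul_eq_mul, mul_one] at h4
  refine h1.ge.trans ?_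
  rw [sq, goodAbscissas]
  exact Nat.add_le_add_left (h4.trans (h3.trans h2)) _

theorem fiberCard_le (hf : IsPlaneCurve f) (a : ZMod p) : fiberCard p f a ≤ f.natDegree := by
  classical
  set q := f.map (evalRingHom (algebraMap (ZMod p) k a)) with hq
  have hm : q.Monic := hf.monic.map _
  have h1 := sum_rootMultiplicity_le (Finset.univ.filter fun b : ZMod p =>
    evalEval (algebraMap (ZMod p) k a) (algebraMap (ZMod p) k b) f = 0)
    (algebraMap (ZMod p) k).injective q
  have h2 := Finset.card_nsmul_le_sum (Finset.univ.filter fun b : ZMod p =>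
    evalEval (algebraMap (ZMod p) k a) (algebraMap (ZMod p) k b) f = 0)
    (fun b => q.rootMultiplicity (algebraMap (ZMod p) k b)) 1 (fun b hb => by
      rw [Finset.mem_filter, ← map_evalRingHom_eval] at hb
      exact (rootMultiplicity_pos hm.ne_zero).2 hb.2)
  rw [smul_eq_mul, mul_one] at h2
  rw [fiberCard]
  exact h2.trans (h1.trans_eq (hf.monic.natDegree_map _))

theorem sum_fiberCard_le [IsAlgClosed k] (hf : IsPlaneCurve f)
    (hd : 2 ≤ f.natDegree) (hchar : ∀ j, 0 < j → j ≤ f.natDegree → (j : k) ≠ 0) :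
    ∑ a, fiberCard p f a ≤ ∑ a ∈ goodAbscissas p f, fiberCard p f a + f.natDegree ^ 3 := by
  classical
  have h1 := card_le_card_goodAbscissas_add (p := p) hf hd hchar
  have h2 := Finset.card_add_card_compl (goodAbscissas p f)
  rw [ZMod.card] at h2
  rw [← Finset.sum_add_sum_compl (goodAbscissas p f)]
  refine Nat.add_le_add_left ?_ _
  refine (Finset.sum_le_card_nsmul _ _ f.natDegree fun a _ => fiberCard_le hf a).trans ?_
  rw [smul_eq_mul, pow_succ]
  exact Nat.mul_le_mul_right _ (by omega)

theorem upper_bound_of_parameters [IsAlgClosed k] [CharP k p] (hf : IsPlaneCurve f)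
    (hfr : f.map (mapRingHom (frobenius k p)) = f) (hd2 : 2 ≤ f.natDegree)
    (hd : (f.natDegree : k) ≠ 0) {M T n₀ D L : ℕ} (hT : f.natDegree * T < p)
    (hn₀ : n₀ + f.natDegree + 1 * M + (f.natDegree - 1) ≤ T) (hL : D + L = M)
    (hdim : f.natDegree * L * ((T + 1) * f.natDegree) <
      M * (f.natDegree - 1) * (n₀ * f.natDegree)) :
    M * ∑ a ∈ goodAbscissas p f, fiberCard p f a ≤
      f.natDegree * (T + p * (D + f.natDegree)) := by
  classical
  obtain ⟨θ, hθm, hθ, hdvd⟩ := exists_dvd_graph hf hfr hd (linear_mul_cofactor hfr) le_rfl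
    linearFactor_mem (eq_zero_of_dvd_linearFactor_pow_mul hf hd) hT hn₀ hL hdim
  refine le_trans ?_ ((sum_rootMultiplicity_le (goodAbscissas p f)
    (algebraMap (ZMod p) k).injective _).trans (natDegree_norm_le_of_mem_fil hf hθm))
  rw [Finset.mul_sum]
  refine Finset.sum_le_sum fun a ha => ?_
  rw [goodAbscissas, Finset.mem_filter] at ha
  obtain ⟨h1, h2⟩ := rootMultiplicity_norm_cofactor hf hfr hd2 ha.2
  have h3 := mul_le_of_dvd_graph hf h1 hθ hdvd a
  rw [← h2, add_mul, mul_comm _ M, mul_comm _ M] at h3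
  omega

theorem lower_bound_of_parameters [IsAlgClosed k] [CharP k p] (hf : IsPlaneCurve f)
    (hfr : f.map (mapRingHom (frobenius k p)) = f) (hd2 : 2 ≤ f.natDegree)
    (hd : (f.natDegree : k) ≠ 0) {M T n₀ D L : ℕ} (hT : f.natDegree * T < p)
    (hn₀ : n₀ + f.natDegree + (f.natDegree - 1) * M + 1 ≤ T) (hL : D + L = M)
    (hdim : f.natDegree * L * ((T + 1) * f.natDegree) < M * 1 * (n₀ * f.natDegree)) :
    f.natDegree * M * (goodAbscissas p f).card ≤
      M * ∑ a ∈ goodAbscissas p f, fiberCard p f a +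
        f.natDegree * (T + p * (D + f.natDegree)) := by
  classical
  have hmem : cofactor f ∈ (fil f).poly.poly.carrier ((f.natDegree - 1 : ℕ) : ℤ) := by
    rw [Nat.cast_sub (by omega)]
    exact_mod_cast cofactor_mem hf
  obtain ⟨θ, hθm, hθ, hdvd⟩ := exists_dvd_graph hf hfr hd
    ((mul_comm _ _).trans (linear_mul_cofactor hfr)) (by omega)
    hmem (eq_zero_of_dvd_cofactor_pow_mul hf hd) hT hn₀ hL hdim
  refine le_trans ?_ (Nat.add_le_add_left ((sum_rootMultiplicity_le (goodAbscissas p f)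
    (algebraMap (ZMod p) k).injective _).trans (natDegree_norm_le_of_mem_fil hf hθm)) _)
  rw [Finset.mul_sum, ← Finset.sum_add_distrib, mul_comm _ (Finset.card _), ← smul_eq_mul]
  refine Finset.card_nsmul_le_sum _ _ _ fun a ha => ?_
  rw [goodAbscissas, Finset.mem_filter] at ha
  have h1 := rootMultiplicity_norm_linear hf hd2 ha.2
  rw [← h1, ← graphEval_linearFactor]
  refine mul_le_of_dvd_graph hf ?_ hθ hdvd a
  intro h0
  have h2 := (linear_mul_cofactor (p := p) hfr)
  rw [graphEval_linearFactor, root_pow_sub_root] at h0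
  have := isDomain hf
  rcases mul_eq_zero.1 h0 with h | h
  · simp at h
  · obtain ⟨c, -, hc⟩ := Finset.prod_eq_zero_iff.1 h
    exact of_sub_root_ne_zero hf hd2 _ hc

end PlaneCurve

theorem exists_parameters {d p M n δ : ℕ} (hnδ : n + δ = d) (hn : 1 ≤ n) (hδ : 1 ≤ δ)
    (hmul : n * δ ≤ d) (hp : M * M ≤ p) (h6 : 6 * d ^ 2 ≤ n * M) (h4 : d * δ + 4 * d ≤ M) :
    ∃ T n₀ D L, d * T < p ∧ n₀ + d + δ * M + n ≤ T ∧ D + L = M ∧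
      d * L * ((T + 1) * d) < M * n * (n₀ * d) ∧ d * (D + d) ≤ δ * M + 7 * d ^ 2 := by
  have hd : 2 ≤ d := by omega
  have hM : 8 ≤ M := by nlinarith
  have hp0 : 0 < p := by nlinarith
  obtain ⟨T, hT1, hT2⟩ : ∃ T, d * T < p ∧ p ≤ d * (T + 1) := by
    refine ⟨(p - 1) / d, ?_, ?_⟩
    · have := Nat.mul_div_le (p - 1) d
      omega
    · have := Nat.lt_mul_div_succ (p - 1) (show 0 < d by omega)
      omega
  obtain ⟨E, hE1, hE2⟩ : ∃ E, δ * M + 6 * d ^ 2 ≤ d * E ∧ d * E ≤ δ * M + 7 * d ^ 2 := by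
    refine ⟨(δ * M + 6 * d ^ 2) / d + 1, ?_, ?_⟩
    · exact (Nat.lt_mul_div_succ _ (by omega)).le
    · have := Nat.mul_div_le (δ * M + 6 * d ^ 2) d
      nlinarith
  have hEd : d ≤ E := by
    by_contra! h
    nlinarith
  obtain ⟨D, rfl⟩ := Nat.exists_eq_add_of_le' hEd
  have hDM : D ≤ M := by
    have h1 : d * D ≤ d * M := by
      have : d * M = n * M + δ * M := by rw [← hnδ]; ring
      nlinarith
    exact Nat.le_of_mul_le_mul_left h1 (by omega)
  obtain ⟨L, hL⟩ := Nat.exists_eq_add_of_le hDM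
  have hTe : d + δ * M + n ≤ T := by
    have h1 : d * (d + δ * M + n + 1) ≤ d * (T + 1) := by
      have h2 : M * (d * δ + 4 * d) ≤ M * M := Nat.mul_le_mul_left _ h4
      have h3 : d * (n + 1) ≤ d * d := Nat.mul_le_mul_left _ (by omega)
      have h5 : d * d ≤ d * M := Nat.mul_le_mul_left _ (by nlinarith)
      nlinarith
    have := Nat.le_of_mul_le_mul_left h1 (by omega)
    omega
  obtain ⟨n₀, hn₀⟩ := Nat.exists_eq_add_of_le' hTe
  refine ⟨T, n₀, D, L, hT1, by omega, hL.symm, ?_, hE2⟩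
  suffices h : d * L * (T + 1) < M * n * n₀ by
    calc d * L * ((T + 1) * d) = d * L * (T + 1) * d := by ring
      _ < M * n * n₀ * d := Nat.mul_lt_mul_of_pos_right h (by omega)
      _ = _ := by ring
  have hdL : d * L + 5 * d ^ 2 ≤ n * M := by
    have h1 : d * M = n * M + δ * M := by rw [← hnδ]; ring
    have h2 : d * M = d * D + d * L := by rw [hL]; ring
    nlinarith
  have hn0T : T + 1 ≤ n₀ + (δ * M + 2 * d) := by omega
  have h1 : (d * L + 5 * d ^ 2) * (T + 1) ≤ n * M * (T + 1) := Nat.mul_le_mul_right _ hdL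
  have h2 : n * M * (T + 1) ≤ n * M * (n₀ + (δ * M + 2 * d)) := Nat.mul_le_mul_left _ hn0T
  have h3 : n * M * (δ * M + 2 * d) < 5 * d ^ 2 * (T + 1) := by
    have e1 : n * δ * (M * M) ≤ d * (M * M) := Nat.mul_le_mul_right _ hmul
    have e2 : n * (M * (2 * d)) ≤ d * (M * (2 * d)) := Nat.mul_le_mul_right _ (by omega)
    have e3 : d * M * (2 * d) ≤ d * M * (2 * M) := Nat.mul_le_mul_left _ (by nlinarith)
    have e4 : 5 * d * (M * M) ≤ 5 * d * (d * (T + 1)) := Nat.mul_le_mul_left _ (hp.trans hT2)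
    have e5 : 0 < d * (M * M) := by positivity
    nlinarith
  nlinarith

namespace PlaneCurve

theorem natCast_ne_zero_of_lt {k : Type*} [Field k] {p : ℕ} [CharP k p] {j : ℕ} (h0 : 0 < j)
    (hj : j < p) : (j : k) ≠ 0 := by
  rw [Ne, CharP.cast_eq_zero_iff k p]
  exact fun h => absurd (Nat.le_of_dvd h0 h) (by omega)

variable {k : Type*} [Field k] [IsAlgClosed k] {f : k[X][X]} {p : ℕ} [Fact p.Prime]
  [Algebra (ZMod p) k] [CharP k p]

theorem sum_fiberCard_le_add (hf : IsPlaneCurve f)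
    (hfr : f.map (mapRingHom (frobenius k p)) = f) (hd : 2 ≤ f.natDegree) :
    ∑ a, fiberCard p f a ≤ p + 36 * f.natDegree ^ 2 * Nat.sqrt p := by
  have hM1 := Nat.sqrt_le p
  have hM2 := Nat.sqrt_le_add p
  have hM0 : 0 < Nat.sqrt p := Nat.sqrt_pos.2 (Fact.out : p.Prime).pos
  set M := Nat.sqrt p with hM
  set d := f.natDegree with hd'
  rcases lt_or_ge M (12 * d) with h | h
  · have h1 : ∑ a, fiberCard p f a ≤ p * d := by
      have := Finset.sum_le_card_nsmul (Finset.univ : Finset (ZMod p)) (fiberCard p f) d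
        fun a _ => fiberCard_le hf a
      rwa [Finset.card_univ, ZMod.card, smul_eq_mul] at this
    have h2 : p ≤ 3 * (M * M) := by nlinarith
    have h3 : p * d ≤ 3 * (M * M) * d := Nat.mul_le_mul_right _ h2
    have h4 : M * (M * d) ≤ (12 * d) * (M * d) := Nat.mul_le_mul_right _ h.le
    nlinarith
  · have hdp : d < p := by nlinarith
    have hchar : ∀ j, 0 < j → j ≤ d → (j : k) ≠ 0 := fun j h0 hj =>
      natCast_ne_zero_of_lt h0 (hj.trans_lt hdp)
    obtain ⟨T, n₀, D, L, hT, hn₀, hL, hdim, hD⟩ := exists_parameters (d := d) (p := p) (M := M)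
      (n := d - 1) (δ := 1) (by omega) (by omega) le_rfl (by omega) hM1
      (by obtain ⟨e, he⟩ : ∃ e, d = e + 1 := ⟨d - 1, by omega⟩
          rw [he] at h hd ⊢
          simp only [Nat.add_sub_cancel]
          nlinarith) (by omega)
    have h1 := upper_bound_of_parameters hf hfr hd (hchar d (by omega) le_rfl) hT hn₀ hL hdim
    have h2 := sum_fiberCard_le (p := p) hf hd hchar
    set S := ∑ a ∈ goodAbscissas p f, fiberCard p f a with hS
    rw [← hd'] at h1 h2
    have h3 : M * S ≤ p + p * (M + 7 * d ^ 2) := by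
      have : p * (d * (D + d)) ≤ p * (1 * M + 7 * d ^ 2) := Nat.mul_le_mul_left _ hD
      nlinarith
    have h4 : M * S ≤ M * (p + (M + 2) * (8 * d ^ 2)) := by
      have h5 : p * (1 + 7 * d ^ 2) ≤ (M * (M + 2)) * (1 + 7 * d ^ 2) :=
        Nat.mul_le_mul_right _ (by nlinarith)
      have h6 : (M * (M + 2)) * 1 ≤ (M * (M + 2)) * d ^ 2 :=
        Nat.mul_le_mul_left _ (by nlinarith)
      nlinarith
    have h7 := Nat.le_of_mul_le_mul_left h4 hM0
    have h8 : d ^ 2 * d ≤ d ^ 2 * M := Nat.mul_le_mul_left _ (by omega)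
    have h9 : 2 * d ^ 2 ≤ M * d ^ 2 := Nat.mul_le_mul_right _ (by omega)
    nlinarith

theorem le_sum_fiberCard_add (hf : IsPlaneCurve f)
    (hfr : f.map (mapRingHom (frobenius k p)) = f) (hd : 2 ≤ f.natDegree) :
    p ≤ ∑ a, fiberCard p f a + 36 * f.natDegree ^ 2 * Nat.sqrt p := by
  have hM1 := Nat.sqrt_le p
  have hM2 := Nat.sqrt_le_add p
  have hM0 : 0 < Nat.sqrt p := Nat.sqrt_pos.2 (Fact.out : p.Prime).pos
  set M := Nat.sqrt p with hM
  set d := f.natDegree with hd'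
  rcases lt_or_ge M (6 * d ^ 2) with h | h
  · have h2 : p ≤ 3 * (M * M) := by nlinarith
    have h4 : M * M ≤ (6 * d ^ 2) * M := Nat.mul_le_mul_right _ h.le
    linarith [Nat.zero_le (d ^ 2 * M), Nat.zero_le (∑ a, fiberCard p f a)]
  · have hdM : 12 * d ≤ M := by nlinarith
    have hdp : d < p := by nlinarith
    have hchar : ∀ j, 0 < j → j ≤ d → (j : k) ≠ 0 := fun j h0 hj =>
      natCast_ne_zero_of_lt h0 (hj.trans_lt hdp)
    obtain ⟨T, n₀, D, L, hT, hn₀, hL, hdim, hD⟩ := exists_parameters (d := d) (p := p) (M := M)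
      (n := 1) (δ := d - 1) (by omega) le_rfl (by omega) (by omega) hM1 (by omega)
      (by have : d * (d - 1) ≤ d * d := Nat.mul_le_mul_left _ (by omega)
          nlinarith)
    have h1 := lower_bound_of_parameters hf hfr hd (hchar d (by omega) le_rfl) hT hn₀ hL hdim
    have h2 := card_le_card_goodAbscissas_add (p := p) hf hd hchar
    have h3 : ∑ a ∈ goodAbscissas p f, fiberCard p f a ≤ ∑ a, fiberCard p f a :=
      Finset.sum_le_sum_of_subset (Finset.subset_univ _)
    set S := ∑ a ∈ goodAbscissas p f, fiberCard p f a with hS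
    set N := ∑ a, fiberCard p f a with hN
    set g := (goodAbscissas p f).card with hg
    rw [← hd'] at h1 h2
    have h5 : d * M * p ≤ d * M * (g + d ^ 2) := Nat.mul_le_mul_left _ h2
    have h6 : M * S ≤ M * N := Nat.mul_le_mul_left _ h3
    have h7 : p * (d * (D + d)) ≤ p * ((d - 1) * M + 7 * d ^ 2) := Nat.mul_le_mul_left _ hD
    have h8 : (d - 1) * M + M = d * M := by
      rw [← Nat.succ_mul]; congr 1; omega
    have h9 : p * ((d - 1) * M + 7 * d ^ 2) + p * M = p * (d * M) + p * (7 * d ^ 2) := by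
      rw [← h8]; ring
    have h10 : M * p ≤ M * N + p * (1 + 7 * d ^ 2) + M * d ^ 3 := by
      have e1 : d * M * (g + d ^ 2) = d * (M * g) + M * d ^ 3 := by ring
      have e2 : d * M * p = p * (d * M) := by ring
      rw [e1, e2] at h5
      have e3 : p * (1 + 7 * d ^ 2) = p + p * (7 * d ^ 2) := by ring
      have e4 : p * M = M * p := mul_comm _ _
      rw [e3]
      have e5 : d * (p * (D + d)) = p * (d * (D + d)) := by ring
      have e6 : d * (T + p * (D + d)) = d * T + d * (p * (D + d)) := mul_add _ _ _
      have e7 : d * M * g = d * (M * g) := mul_assoc _ _ _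
      linarith
    have h11 : M * p ≤ M * (N + (M + 2) * (8 * d ^ 2) + d ^ 3) := by
      have h5 : p * (1 + 7 * d ^ 2) ≤ (M * (M + 2)) * (1 + 7 * d ^ 2) :=
        Nat.mul_le_mul_right _ (by rw [mul_add]; omega)
      have h6 : (M * (M + 2)) * 1 ≤ (M * (M + 2)) * d ^ 2 :=
        Nat.mul_le_mul_left _ (Nat.one_le_pow _ _ (by omega))
      have e1 : M * (N + (M + 2) * (8 * d ^ 2) + d ^ 3)
          = M * N + 8 * (M * (M + 2) * d ^ 2) + M * d ^ 3 := by ring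
      have e2 : M * (M + 2) * (1 + 7 * d ^ 2)
          = M * (M + 2) * 1 + 7 * (M * (M + 2) * d ^ 2) := by ring
      rw [e1]
      rw [e2] at h5
      linarith
    have h12 := Nat.le_of_mul_le_mul_left h11 hM0
    have h13 : d ^ 2 * d ≤ d ^ 2 * M := Nat.mul_le_mul_left _ (by omega)
    have h14 : 2 * d ^ 2 ≤ M * d ^ 2 := Nat.mul_le_mul_right _ (by omega)
    nlinarith

end PlaneCurve

namespace PlaneCurve

section Sub

variable {k : Type*} [Field k] {P Q : k[X]}

theorem degree_C_lt_degree_map (hQ : 0 < Q.natDegree) :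
    (C P : k[X][X]).degree < (Q.map C).degree := by
  rw [degree_map_eq_of_injective C_injective]
  exact degree_C_le.trans_lt (natDegree_pos_iff_degree_pos.1 hQ)

/-- The polynomial `Q(y) - P(x)`, made monic in `y`. -/
noncomputable def monicSub (P Q : k[X]) : k[X][X] :=
  C (C Q.leadingCoeff⁻¹) * (Q.map C - C P)

theorem leadingCoeff_map_sub (hQ : 0 < Q.natDegree) :
    (Q.map C - C P : k[X][X]).leadingCoeff = C Q.leadingCoeff := by
  rw [leadingCoeff_sub_of_degree_lt (degree_C_lt_degree_map hQ),
    leadingCoeff_map_of_injective C_injective]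

theorem monic_monicSub (hQ : 0 < Q.natDegree) : (monicSub P Q).Monic := by
  have : Q.leadingCoeff ≠ 0 := by
    rw [leadingCoeff_ne_zero]; rintro rfl; simp at hQ
  rw [Monic, monicSub, leadingCoeff_mul, leadingCoeff_map_sub hQ, leadingCoeff_C, ← C_mul,
    inv_mul_cancel₀ this, C_1]

theorem natDegree_monicSub (hQ : 0 < Q.natDegree) : (monicSub P Q).natDegree = Q.natDegree := by
  have : Q.leadingCoeff ≠ 0 := by
    rw [leadingCoeff_ne_zero]; rintro rfl; simp at hQ
  rw [monicSub, natDegree_C_mul (by simpa using this),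
    natDegree_eq_of_degree_eq (degree_sub_eq_left_of_degree_lt (degree_C_lt_degree_map hQ)),
    natDegree_map_eq_of_injective C_injective]

theorem monicSub_mem (hPQ : P.natDegree ≤ Q.natDegree) :
    monicSub P Q ∈ (DegFil.triv k k).poly.poly.carrier Q.natDegree := fun i => by
  rw [monicSub, coeff_C_mul, coeff_sub, coeff_map, coeff_C]
  rcases lt_or_ge Q.natDegree i with hi | hi
  · rw [coeff_eq_zero_of_natDegree_lt hi, if_neg (by omega)]
    simp
  · have h : ((Q.natDegree : ℤ) - i) = ((Q.natDegree - i : ℕ) : ℤ) := by omega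
    rw [h]
    refine DegFil.mem_triv_poly_of_natDegree_le ((natDegree_C_mul_le _ _).trans
      ((natDegree_sub_le _ _).trans (max_le (by simp) ?_)))
    split_ifs with h0
    · subst h0; simpa using hPQ
    · simp

end Sub

section Count

variable {k : Type*} [Field k] {p : ℕ} [Fact p.Prime] [Algebra (ZMod p) k]
  {f : (ZMod p)[X][X]}

theorem evalEval_map_algebraMap (a b : ZMod p) :
    evalEval (algebraMap (ZMod p) k a) (algebraMap (ZMod p) k b)
      (f.map (mapRingHom (algebraMap (ZMod p) k))) = algebraMap (ZMod p) k (evalEval a b f) :=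
  map_mapRingHom_evalEval _ _ _ _

theorem sum_fiberCard_eq_ncard :
    ∑ a, fiberCard p (f.map (mapRingHom (algebraMap (ZMod p) k))) a =
      {xy : ZMod p × ZMod p | evalEval xy.1 xy.2 f = 0}.ncard := by
  classical
  simp only [fiberCard, evalEval_map_algebraMap, map_eq_zero]
  have : {xy : ZMod p × ZMod p | evalEval xy.1 xy.2 f = 0} =
      (Finset.univ.filter fun xy : ZMod p × ZMod p => evalEval xy.1 xy.2 f = 0 :
        Finset (ZMod p × ZMod p)) := by
    ext; simp
  rw [this, Set.ncard_coe_finset, Finset.card_filter, Fintype.sum_prod_type]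
  simp only [Finset.card_filter]

theorem map_frobenius_map [CharP k p] :
    (f.map (mapRingHom (algebraMap (ZMod p) k))).map (mapRingHom (frobenius k p)) =
      f.map (mapRingHom (algebraMap (ZMod p) k)) := by
  rw [Polynomial.map_map, mapRingHom_comp]
  congr 2
  ext a
  rw [RingHom.comp_apply, frobenius_def, ← map_pow, ZMod.pow_card]

theorem ncard_eq_of_natDegree_eq_one (hf : f.Monic) (hd : f.natDegree = 1) :
    {xy : ZMod p × ZMod p | evalEval xy.1 xy.2 f = 0}.ncard = p := by
  have h1 : f = X + C (f.coeff 0) := hf.eq_X_add_C hd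
  have h2 : {xy : ZMod p × ZMod p | evalEval xy.1 xy.2 f = 0} =
      Set.range fun a : ZMod p => (a, -(f.coeff 0).eval a) := by
    ext ⟨a, b⟩
    rw [Set.mem_ofPred_eq, h1, evalEval_add, evalEval_X, evalEval_C]
    simp [neg_eq_iff_add_eq_zero, add_comm]
  rw [h2, ← Set.image_univ, Set.ncard_image_of_injective _ fun a b h => (Prod.ext_iff.1 h).1,
    Set.ncard_univ, Nat.card_zmod]

theorem isPlaneCurve_map (hf : f.Monic)
    (hmem : f ∈ (DegFil.triv (ZMod p) (ZMod p)).poly.poly.carrier f.natDegree)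
    (hirr : Irreducible (f.map (mapRingHom (algebraMap (ZMod p) k)))) :
    IsPlaneCurve (f.map (mapRingHom (algebraMap (ZMod p) k))) where
  monic := hf.map _
  irreducible := hirr
  mem i := by
    rw [hf.natDegree_map, coeff_map]
    rcases lt_or_ge f.natDegree i with hi | hi
    · rw [coeff_eq_zero_of_natDegree_lt hi]
      simp
    · have h : ((f.natDegree : ℤ) - i) = ((f.natDegree - i : ℕ) : ℤ) := by omega
      have h1 := hmem i
      rw [h] at h1 ⊢
      exact DegFil.mem_triv_poly_of_natDegree_le
        (natDegree_map_le.trans (DegFil.natDegree_le_of_mem_triv_poly h1))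

theorem abs_ncard_sub_le (hf : f.Monic)
    (hmem : f ∈ (DegFil.triv (ZMod p) (ZMod p)).poly.poly.carrier f.natDegree)
    (hirr : Irreducible (f.map (mapRingHom (algebraMap (ZMod p) (AlgebraicClosure (ZMod p)))))) :
    |({xy : ZMod p × ZMod p | evalEval xy.1 xy.2 f = 0}.ncard : ℝ) - p| ≤
      36 * (f.natDegree : ℝ) ^ 2 * Real.sqrt p := by
  rcases lt_or_ge f.natDegree 2 with hd | hd
  · interval_cases h : f.natDegree
    · rw [hf.natDegree_eq_zero.1 h, Polynomial.map_one] at hirr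
      exact absurd isUnit_one hirr.not_isUnit
    · rw [ncard_eq_of_natDegree_eq_one hf h, sub_self, abs_zero]
      positivity
  · have hc := isPlaneCurve_map hf hmem hirr
    have hd' := hd
    rw [← hf.natDegree_map (mapRingHom (algebraMap (ZMod p) (AlgebraicClosure (ZMod p))))] at hd'
    have h1 := sum_fiberCard_le_add (p := p) hc map_frobenius_map hd'
    have h2 := le_sum_fiberCard_add (p := p) hc map_frobenius_map hd'
    rw [hf.natDegree_map, sum_fiberCard_eq_ncard] at h1 h2
    have h3 : 36 * (f.natDegree : ℝ) ^ 2 * (Nat.sqrt p : ℝ) ≤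
        36 * (f.natDegree : ℝ) ^ 2 * Real.sqrt p :=
      mul_le_mul_of_nonneg_left Real.nat_sqrt_le_real_sqrt (by positivity)
    refine le_trans ?_ h3
    rw [abs_sub_le_iff, sub_le_iff_le_add', sub_le_iff_le_add']
    exact ⟨by exact_mod_cast h1, by exact_mod_cast h2⟩

end Count

section Transfer

theorem eval_equivMvPolynomial {R : Type*} [CommRing R] (a b : R) (g : R[X][X]) :
    MvPolynomial.eval ![a, b] (Bivariate.equivMvPolynomial R g) = evalEval a b g := by
  have : (MvPolynomial.eval ![a, b]).comp
      (Bivariate.equivMvPolynomial R : R[X][X] →+* MvPolynomial (Fin 2) R) =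
      evalEvalRingHom a b := by
    ext <;> simp
  exact DFunLike.congr_fun this g

theorem map_equivMvPolynomial {R S : Type*} [CommRing R] [CommRing S] (φ : R →+* S)
    (g : R[X][X]) :
    MvPolynomial.map φ (Bivariate.equivMvPolynomial R g) =
      Bivariate.equivMvPolynomial S (g.map (mapRingHom φ)) := by
  have : (MvPolynomial.map φ).comp
      (Bivariate.equivMvPolynomial R : R[X][X] →+* MvPolynomial (Fin 2) R) =
      (Bivariate.equivMvPolynomial S : S[X][X] →+* MvPolynomial (Fin 2) S).comp
        (mapRingHom (mapRingHom φ)) := by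
    ext <;> simp
  exact DFunLike.congr_fun this g

theorem natDegree_equivMvPolynomial_symm_le {R : Type*} [CommRing R]
    (ψ : MvPolynomial (Fin 2) R) :
    ((Bivariate.equivMvPolynomial R).symm ψ).natDegree ≤ ψ.totalDegree := by
  have h : (Bivariate.equivMvPolynomial R).symm ψ =
      MvPolynomial.aeval (![C X, X] : Fin 2 → R[X][X]) ψ := rfl
  rw [h, MvPolynomial.aeval_def, MvPolynomial.eval₂_eq']
  refine natDegree_sum_le_of_forall_le _ _ fun s hs => ?_
  have h1 : s 1 ≤ ψ.totalDegree := by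
    refine le_trans ?_ (MvPolynomial.le_totalDegree hs)
    rw [Finsupp.sum_fintype _ _ fun _ => rfl, Fin.sum_univ_two]
    exact Nat.le_add_left _ _
  rw [Fin.prod_univ_two]
  refine le_trans ?_ h1
  rw [← mul_assoc]
  have e : algebraMap R R[X][X] (ψ.coeff s) * (![C X, X] : Fin 2 → R[X][X]) 0 ^ s 0 *
      (![C X, X] : Fin 2 → R[X][X]) 1 ^ s 1 = C (C (ψ.coeff s) * X ^ s 0) * X ^ s 1 := by
    simp [Polynomial.algebraMap_apply]
  rw [e]
  exact natDegree_C_mul_X_pow_le _ _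

theorem aeval_X_zero {R : Type*} [CommRing R] (P : R[X]) :
    Polynomial.aeval (MvPolynomial.X 0 : MvPolynomial (Fin 2) R) P =
      Bivariate.equivMvPolynomial R (C P) := by
  induction P using Polynomial.induction_on' with
  | add P Q hP hQ => rw [map_add, C_add, map_add, hP, hQ]
  | monomial n a =>
    rw [← C_mul_X_pow_eq_monomial]
    simp only [map_mul, map_pow, Polynomial.aeval_C, Polynomial.aeval_X,
      Bivariate.equivMvPolynomial_C_C, Bivariate.equivMvPolynomial_C_X,
      MvPolynomial.algebraMap_eq]

theorem aeval_X_one {R : Type*} [CommRing R] (P : R[X]) :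
    Polynomial.aeval (MvPolynomial.X 1 : MvPolynomial (Fin 2) R) P =
      Bivariate.equivMvPolynomial R (P.map C) := by
  induction P using Polynomial.induction_on' with
  | add P Q hP hQ => rw [map_add, Polynomial.map_add, map_add, hP, hQ]
  | monomial n a =>
    rw [← C_mul_X_pow_eq_monomial]
    simp only [map_mul, map_pow, Polynomial.aeval_C, Polynomial.aeval_X, Polynomial.map_mul,
      Polynomial.map_pow, Polynomial.map_C, Polynomial.map_X,
      Bivariate.equivMvPolynomial_C_C, Bivariate.equivMvPolynomial_X,
      MvPolynomial.algebraMap_eq]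

variable {p : ℕ} [Fact p.Prime]

theorem abs_ncard_sub_le_of_monic {ψ : MvPolynomial (Fin 2) (ZMod p)} {f : (ZMod p)[X][X]}
    {c : ZMod p} (hc : c ≠ 0) (hψ : ψ = Bivariate.equivMvPolynomial (ZMod p) (C (C c) * f))
    (hf : f.Monic) (hmem : f ∈ (DegFil.triv (ZMod p) (ZMod p)).poly.poly.carrier f.natDegree)
    (hirr : Irreducible
      (MvPolynomial.map (algebraMap (ZMod p) (AlgebraicClosure (ZMod p))) ψ)) :
    |((Set.ncard {xy : ZMod p × ZMod p | MvPolynomial.eval ![xy.1, xy.2] ψ = 0} : ℝ)) -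
      (p : ℝ)| ≤ 36 * (ψ.totalDegree : ℝ) ^ 2 * Real.sqrt p := by
  have h1 : {xy : ZMod p × ZMod p | MvPolynomial.eval ![xy.1, xy.2] ψ = 0} =
      {xy | evalEval xy.1 xy.2 f = 0} := by
    ext xy
    simp [hψ, eval_equivMvPolynomial, hc]
  have h2 : f.natDegree ≤ ψ.totalDegree := by
    have := natDegree_equivMvPolynomial_symm_le ψ
    rwa [hψ, AlgEquiv.symm_apply_apply, natDegree_C_mul (by simpa using hc), ← hψ] at this
  have h3 : Irreducible
      (f.map (mapRingHom (algebraMap (ZMod p) (AlgebraicClosure (ZMod p))))) := by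
    rw [hψ, map_equivMvPolynomial, MulEquiv.irreducible_iff, Polynomial.map_mul] at hirr
    refine (irreducible_isUnit_mul ?_).1 hirr
    simpa using hc
  rw [h1]
  refine (PlaneCurve.abs_ncard_sub_le hf hmem h3).trans ?_
  gcongr

theorem not_irreducible_map_C (c : ZMod p) : ¬ Irreducible
    (MvPolynomial.map (algebraMap (ZMod p) (AlgebraicClosure (ZMod p)))
      (MvPolynomial.C c : MvPolynomial (Fin 2) (ZMod p))) := by
  intro h
  rw [MvPolynomial.map_C] at h
  by_cases hc : c = 0
  · exact h.ne_zero (by simp [hc])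
  · exact h.not_isUnit ((IsUnit.mk0 _ (by simpa using hc)).map MvPolynomial.C)

theorem abs_ncard_sub_le_of_natDegree_le {P Q : (ZMod p)[X]} (h : P.natDegree ≤ Q.natDegree)
    (hirr : Irreducible (MvPolynomial.map (algebraMap (ZMod p) (AlgebraicClosure (ZMod p)))
      (Polynomial.aeval (MvPolynomial.X 0 : MvPolynomial (Fin 2) (ZMod p)) P -
        Polynomial.aeval (MvPolynomial.X 1 : MvPolynomial (Fin 2) (ZMod p)) Q))) :
    |((Set.ncard {xy : ZMod p × ZMod p | MvPolynomial.eval ![xy.1, xy.2]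
      (Polynomial.aeval (MvPolynomial.X 0 : MvPolynomial (Fin 2) (ZMod p)) P -
        Polynomial.aeval (MvPolynomial.X 1 : MvPolynomial (Fin 2) (ZMod p)) Q) = 0} : ℝ)) -
      (p : ℝ)| ≤ 36 * ((Polynomial.aeval (MvPolynomial.X 0 : MvPolynomial (Fin 2) (ZMod p)) P -
        Polynomial.aeval (MvPolynomial.X 1 : MvPolynomial (Fin 2) (ZMod p)) Q).totalDegree : ℝ) ^ 2
        * Real.sqrt p := by
  rcases Nat.eq_zero_or_pos Q.natDegree with h0 | h0
  · rw [h0, Nat.le_zero] at h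
    rw [eq_C_of_natDegree_eq_zero h, eq_C_of_natDegree_eq_zero h0] at hirr
    simp only [Polynomial.aeval_C, MvPolynomial.algebraMap_eq, ← MvPolynomial.C_sub] at hirr
    exact absurd hirr (not_irreducible_map_C _)
  · have hc : Q.leadingCoeff ≠ 0 := by
      rw [leadingCoeff_ne_zero]; rintro rfl; simp at h0
    refine abs_ncard_sub_le_of_monic (f := PlaneCurve.monicSub P Q) (c := -Q.leadingCoeff)
      (neg_ne_zero.2 hc) ?_ (PlaneCurve.monic_monicSub h0) ?_ hirr
    · rw [aeval_X_zero, aeval_X_one, ← map_sub, PlaneCurve.monicSub, ← mul_assoc, ← C_mul,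
        ← C_mul, neg_mul, mul_inv_cancel₀ hc]
      simp
    · rw [PlaneCurve.natDegree_monicSub h0]
      exact PlaneCurve.monicSub_mem h

theorem abs_ncard_sub_le_of_mul_eq {P : (ZMod p)[X]} {φ : MvPolynomial (Fin 2) (ZMod p)}
    (hφ : φ * (MvPolynomial.X 0 - MvPolynomial.X 1) =
      Polynomial.aeval (MvPolynomial.X 0 : MvPolynomial (Fin 2) (ZMod p)) P -
        Polynomial.aeval (MvPolynomial.X 1 : MvPolynomial (Fin 2) (ZMod p)) P)
    (hirr : Irreducible (MvPolynomial.map (algebraMap (ZMod p) (AlgebraicClosure (ZMod p))) φ)) :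
    |((Set.ncard {xy : ZMod p × ZMod p | MvPolynomial.eval ![xy.1, xy.2] φ = 0} : ℝ)) -
      (p : ℝ)| ≤ 36 * (φ.totalDegree : ℝ) ^ 2 * Real.sqrt p := by
  obtain ⟨g, rfl⟩ := (Bivariate.equivMvPolynomial (ZMod p)).surjective φ
  have hg : g * (X - C X) = P.map C - C P := by
    apply (Bivariate.equivMvPolynomial (ZMod p)).injective
    rw [map_mul, map_sub, map_sub, ← aeval_X_zero P, ← aeval_X_one, Bivariate.equivMvPolynomial_X,
      Bivariate.equivMvPolynomial_C_X]
    linear_combination -hφ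
  have h0 : 0 < P.natDegree := by
    by_contra h
    rw [eq_C_of_natDegree_eq_zero (by omega : P.natDegree = 0), Polynomial.map_C, sub_self,
      mul_eq_zero, or_iff_left (X_sub_C_ne_zero _)] at hg
    exact hirr.ne_zero (by simp [hg])
  have hc : P.leadingCoeff ≠ 0 := by
    rw [leadingCoeff_ne_zero]; rintro rfl; simp at h0
  set f : (ZMod p)[X][X] := C (C P.leadingCoeff⁻¹) * g with hf
  have hfm : (X - C X) * f = PlaneCurve.monicSub P P := by
    rw [PlaneCurve.monicSub, ← hg, hf]; ring
  have hm : f.Monic := (monic_X_sub_C _).of_mul_monic_left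
    (by rw [hfm]; exact PlaneCurve.monic_monicSub h0)
  have hd : f.natDegree + 1 = P.natDegree := by
    rw [← PlaneCurve.natDegree_monicSub (P := P) h0, ← hfm,
      (monic_X_sub_C _).natDegree_mul hm, natDegree_X_sub_C, add_comm]
  refine abs_ncard_sub_le_of_monic hc ?_ hm ?_ hirr
  · rw [hf, ← mul_assoc, ← C_mul, ← C_mul, mul_inv_cancel₀ hc]
    simp
  · have h1 := PlaneCurve.monicSub_mem (le_refl P.natDegree)
    have h2 := ((DegFil.triv (ZMod p) (ZMod p)).poly.divByMonic_modByMonic_mem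
      (monic_X_sub_C X) (natDegree_X_sub_C X) ?_ _ _ h1).1
    · rw [← hfm, mul_divByMonic_cancel_left _ (monic_X_sub_C _)] at h2
      have e : (f.natDegree : ℤ) = (P.natDegree : ℤ) - (1 : ℕ) := by omega
      rwa [e]
    · exact Submodule.sub_mem _ (DegFil.X_mem_poly _) (DegFil.C_mem_poly (DegFil.X_mem_poly _))

theorem abs_ncard_sub_le_of_ne {P Q : (ZMod p)[X]} {φ : MvPolynomial (Fin 2) (ZMod p)}
    (hφ : φ = Polynomial.aeval (MvPolynomial.X 0 : MvPolynomial (Fin 2) (ZMod p)) P -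
        Polynomial.aeval (MvPolynomial.X 1 : MvPolynomial (Fin 2) (ZMod p)) Q)
    (hirr : Irreducible (MvPolynomial.map (algebraMap (ZMod p) (AlgebraicClosure (ZMod p))) φ)) :
    |((Set.ncard {xy : ZMod p × ZMod p | MvPolynomial.eval ![xy.1, xy.2] φ = 0} : ℝ)) -
      (p : ℝ)| ≤ 36 * (φ.totalDegree : ℝ) ^ 2 * Real.sqrt p := by
  rcases le_total P.natDegree Q.natDegree with h | h
  · rw [hφ] at hirr ⊢
    exact abs_ncard_sub_le_of_natDegree_le h hirr
  · set e : Fin 2 ≃ Fin 2 := Equiv.swap 0 1 with he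
    have h1 : Polynomial.aeval (MvPolynomial.X 0 : MvPolynomial (Fin 2) (ZMod p)) Q -
        Polynomial.aeval (MvPolynomial.X 1 : MvPolynomial (Fin 2) (ZMod p)) P =
        -MvPolynomial.renameEquiv (ZMod p) e φ := by
      rw [hφ, map_sub, neg_sub, MvPolynomial.renameEquiv_apply,
        MvPolynomial.renameEquiv_apply, ← Polynomial.aeval_algHom_apply,
        ← Polynomial.aeval_algHom_apply]
      simp [he]
    have h2 := abs_ncard_sub_le_of_natDegree_le h (by
      rw [h1, map_neg, (Associated.neg_left (Associated.refl _)).irreducible_iff,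
        MvPolynomial.renameEquiv_apply, MvPolynomial.map_rename,
        ← MvPolynomial.renameEquiv_apply _ e, MulEquiv.irreducible_iff]
      exact hirr)
    rw [h1, MvPolynomial.totalDegree_neg, MvPolynomial.totalDegree_renameEquiv] at h2
    convert h2 using 4
    rw [← Set.ncard_image_of_injective _ Prod.swap_injective]
    congr 1
    ext ⟨a, b⟩
    have h3 : ![a, b] ∘ e = ![b, a] := by
      ext i; fin_cases i <;> simp [he]
    simp [MvPolynomial.eval_rename, h3]

end Transfer

end PlaneCurve

end Polynomial

open MvPolynomial

/-- **Lemma 4.** If `φ(P,Q)` (equal to `P(x) − Q(y)` when `P ≠ Q`, and to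
`(P(x) − P(y))/(x − y)` when `P = Q`) is absolutely irreducible over `F_p`, then the number
`J(P,Q)` of its zeros in `F_p × F_p` satisfies `|J(P,Q) − p| ≤ C·d²·√p`, where `d` is the
total degree of `φ(P,Q)`. -/
theorem card_zeros_absolutely_irreducible :
    ∃ C : ℝ, C > 0 ∧ ∀ (p : ℕ) [Fact p.Prime], ∀ P Q : Polynomial (ZMod p),
      ∀ φ : MvPolynomial (Fin 2) (ZMod p),
      ((P ≠ Q ∧ φ = Polynomial.aeval (X 0 : MvPolynomial (Fin 2) (ZMod p)) P -
          Polynomial.aeval (X 1 : MvPolynomial (Fin 2) (ZMod p)) Q) ∨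
       (P = Q ∧ φ * (X 0 - X 1) =
          Polynomial.aeval (X 0 : MvPolynomial (Fin 2) (ZMod p)) P -
            Polynomial.aeval (X 1 : MvPolynomial (Fin 2) (ZMod p)) P)) →
      Irreducible (MvPolynomial.map (algebraMap (ZMod p) (AlgebraicClosure (ZMod p))) φ) →
      |((Set.ncard {xy : ZMod p × ZMod p | MvPolynomial.eval ![xy.1, xy.2] φ = 0} : ℝ)) -
          (p : ℝ)| ≤ C * (φ.totalDegree : ℝ) ^ 2 * Real.sqrt p := by
  refine ⟨36, by norm_num, fun p _ P Q φ hφ hirr => ?_⟩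
  rcases hφ with ⟨-, hφ⟩ | ⟨-, hφ⟩
  · exact PlaneCurve.abs_ncard_sub_le_of_ne hφ hirr
  · exact PlaneCurve.abs_ncard_sub_le_of_mul_eq hφ hirr
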